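/- arXiv:1211.0346 — 10 statements merged into one kernel-verified Lean document; each statement's English description precedes it below -/
import Mathlib

section
/- Let A be an n×n complex matrix and c ∈ ℂⁿ. The affine map ω ↦ (1/2)(Iₙ + A)ω + (1/2)c maps the solution set of the equation (Iₙ − A²)ω = (Iₙ + A)c onto the solution set of the equation (Iₙ − A)x = c; that is, for every solution ω of the first equation, x = (1/2)(Iₙ + A)ω + (1/2)c solves the second equation, and every solution of the second equation is of this form for some solution ω of the first equation. -/
open Matrix

/-- The affine map `ω ↦ ½(I + A)ω + ½c` maps the solution set of
`(I - A²)ω = (I + A)c` onto the solution set of `(I - A)x = c`. -/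
theorem stein_reduction_affine_map {n : ℕ} (A : Matrix (Fin n) (Fin n) ℂ) (c : Fin n → ℂ) :
    (∀ ω : Fin n → ℂ, (1 - A ^ 2) *ᵥ ω = (1 + A) *ᵥ c →
      (1 - A) *ᵥ (((1 : ℂ) / 2) • ((1 + A) *ᵥ ω) + ((1 : ℂ) / 2) • c) = c) ∧
    (∀ x : Fin n → ℂ, (1 - A) *ᵥ x = c →
      ∃ ω : Fin n → ℂ, (1 - A ^ 2) *ᵥ ω = (1 + A) *ᵥ c ∧
        x = ((1 : ℂ) / 2) • ((1 + A) *ᵥ ω) + ((1 : ℂ) / 2) • c) := by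
  refine ⟨fun ω hω => ?_, fun x hx => ⟨x, ?_, ?_⟩⟩
  · have hfac : (1 - A) * (1 + A) = 1 - A ^ 2 := by noncomm_ring
    rw [mulVec_add, mulVec_smul, mulVec_smul, mulVec_mulVec, hfac, hω, ← smul_add,
      ← add_mulVec, show (1 + A) + (1 - A) = (2 : ℂ) • (1 : Matrix (Fin n) (Fin n) ℂ) by
        rw [two_smul]; abel, smul_mulVec, one_mulVec, smul_smul]
    norm_num
  · have hfac : (1 + A) * (1 - A) = 1 - A ^ 2 := by noncomm_ring
    rw [← hfac, ← mulVec_mulVec, hx]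
  · rw [← hx, ← smul_add, ← add_mulVec,
      show (1 + A) + (1 - A) = (2 : ℂ) • (1 : Matrix (Fin n) (Fin n) ℂ) by
        rw [two_smul]; abel, smul_mulVec, one_mulVec, smul_smul]
    norm_num
end

section
/- Let A, B ∈ ℂ^{m×n} and set Υ = (Bᵀ ⊗ A)P₍ₘ,ₙ₎ ∈ ℂ^{mn×mn}. Then the spectral radius of Υ equals the spectral radius of BᵀA, i.e. ρ(Υ) = ρ(BᵀA). -/
open Matrix Kronecker

/-- Column-stacking operator: `vecM X : ℂ^{mn}` stacks the columns of `X`. -/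
def vecM {m n : ℕ} (X : Matrix (Fin m) (Fin n) ℂ) : Fin n × Fin m → ℂ :=
  fun p => X p.2 p.1

/-- The commutation matrix `P₍ₘ,ₙ₎`, the unique matrix with
`vecM Xᵀ = commMatrix m n *ᵥ vecM X` for all `X ∈ ℂ^{m×n}`. -/
def commMatrix (m n : ℕ) : Matrix (Fin m × Fin n) (Fin n × Fin m) ℂ :=
  Matrix.of fun p q => if p.1 = q.2 ∧ p.2 = q.1 then (1 : ℂ) else 0

theorem commMatrix_mulVec_vecM {m n : ℕ} (X : Matrix (Fin m) (Fin n) ℂ) :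
    commMatrix m n *ᵥ vecM X = vecM Xᵀ := by
  ext ⟨i, j⟩
  simp [commMatrix, vecM, mulVec, dotProduct, Fintype.sum_prod_type, ite_and]

theorem kronecker_mulVec_vecM {m n : ℕ} (A B : Matrix (Fin m) (Fin n) ℂ)
    (X : Matrix (Fin n) (Fin m) ℂ) :
    (Bᵀ ⊗ₖ A) *ᵥ vecM X = vecM (A * X * B) :=
  kronecker_mulVec_vec A X Bᵀ

theorem kronecker_mul_commMatrix_mulVec_vecM {m n : ℕ} (A B X : Matrix (Fin m) (Fin n) ℂ) :
    ((Bᵀ ⊗ₖ A) * commMatrix m n) *ᵥ vecM X = vecM (A * Xᵀ * B) := by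
  rw [← mulVec_mulVec, commMatrix_mulVec_vecM, kronecker_mulVec_vecM]

theorem Matrix.mem_spectrum_iff_exists_mulVec {K ι : Type*} [Field K] [Fintype ι] [DecidableEq ι]
    {M : Matrix ι ι K} {μ : K} : μ ∈ spectrum K M ↔ ∃ v, v ≠ 0 ∧ M *ᵥ v = μ • v := by
  rw [← spectrum_toLin', ← Module.End.hasEigenvalue_iff_mem_spectrum]
  constructor
  · intro h
    obtain ⟨v, hv⟩ := h.exists_hasEigenvector
    exact ⟨v, hv.2, by simpa using hv.apply_eq_smul⟩
  · rintro ⟨v, hv, h⟩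
    exact Module.End.hasEigenvalue_of_hasEigenvector
      (Module.End.hasEigenvector_iff.2 ⟨Module.End.mem_eigenspace_iff.2 (by simpa using h), hv⟩)

theorem Matrix.mem_spectrum_of_mul_eq_smul {K ι κ : Type*} [Field K] [Fintype ι] [DecidableEq ι]
    {M : Matrix ι ι K} {Y : Matrix ι κ K} {μ : K} (hY : Y ≠ 0) (h : M * Y = μ • Y) :
    μ ∈ spectrum K M := by
  obtain ⟨j, hj⟩ : ∃ j, Y.col j ≠ 0 := by
    by_contra! hcol
    exact hY (by ext i j; exact congrFun (hcol j) i)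
  refine mem_spectrum_iff_exists_mulVec.2 ⟨Y.col j, hj, ?_⟩
  ext i
  exact congrFun (congrFun h i) j

/-- An eigenvalue of `Y ↦ M * Y * Mᵀ` is a product of two eigenvalues of `M`. -/
theorem Matrix.exists_mul_eq_of_mul_mul_transpose_eq_smul {K ι : Type*} [Field K] [IsAlgClosed K]
    [Fintype ι] [DecidableEq ι] {M Y : Matrix ι ι K} {ν : K} (hν : ν ≠ 0) (hY : Y ≠ 0)
    (h : M * Y * Mᵀ = ν • Y) :
    ∃ α ∈ spectrum K M, ∃ β ∈ spectrum K M, α * β = ν := by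
  let f : Module.End K (Matrix ι ι K) := LinearMap.mulLeft K M
  let g : Module.End K (Matrix ι ι K) := LinearMap.mulRight K Mᵀ ∘ₗ LinearMap.mulLeft K M
  have hfg : ∀ Z ∈ g.eigenspace ν, f Z ∈ g.eigenspace ν := by
    intro Z hZ
    rw [Module.End.mem_eigenspace_iff] at hZ ⊢
    simp only [f, g, LinearMap.comp_apply, LinearMap.mulLeft_apply, LinearMap.mulRight_apply]
      at hZ ⊢
    rw [← Matrix.mul_smul, ← hZ]
    simp only [Matrix.mul_assoc]
  have : Nontrivial (g.eigenspace ν) :=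
    ⟨⟨Y, Module.End.mem_eigenspace_iff.2 h⟩, 0, fun e => hY (congrArg Subtype.val e)⟩
  obtain ⟨α, hα⟩ := Module.End.exists_eigenvalue (f.restrict hfg)
  obtain ⟨⟨Z, hZ⟩, hZα⟩ := hα.exists_hasEigenvector
  have hZ0 : Z ≠ 0 := fun e => hZα.2 (Subtype.ext e)
  have hMZ : M * Z = α • Z := congrArg Subtype.val hZα.apply_eq_smul
  have hZν : M * Z * Mᵀ = ν • Z := Module.End.mem_eigenspace_iff.1 hZ
  rw [hMZ, Matrix.smul_mul] at hZν
  have hα0 : α ≠ 0 := by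
    rintro rfl
    rw [zero_smul] at hZν
    exact smul_ne_zero hν hZ0 hZν.symm
  refine ⟨α, mem_spectrum_of_mul_eq_smul hZ0 hMZ, ν / α,
    mem_spectrum_of_mul_eq_smul (transpose_eq_zero.not.2 hZ0) ?_, mul_div_cancel₀ ν hα0⟩
  have := congrArg (fun W => (α⁻¹ • W)ᵀ) hZν
  simpa [smul_smul, hα0, div_eq_inv_mul] using this

theorem mem_spectrum_kronecker_mul_commMatrix {m n : ℕ} {A B : Matrix (Fin m) (Fin n) ℂ} {μ : ℂ}
    (hμ : μ ≠ 0) (h : μ ∈ spectrum ℂ (Bᵀ * A)) :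
    μ ∈ spectrum ℂ ((Bᵀ ⊗ₖ A) * commMatrix m n) := by
  obtain ⟨v, hv, h⟩ := mem_spectrum_iff_exists_mulVec.1 h
  have hAv : A *ᵥ v ≠ 0 := by
    intro e
    rw [← mulVec_mulVec, e, mulVec_zero] at h
    exact smul_ne_zero hμ hv h.symm
  refine mem_spectrum_iff_exists_mulVec.2 ⟨vecM (vecMulVec (A *ᵥ v) v), ?_, ?_⟩
  · obtain ⟨i, hi⟩ := Function.ne_iff.1 hAv
    obtain ⟨j, hj⟩ := Function.ne_iff.1 hv
    exact Function.ne_iff.2 ⟨(j, i), mul_ne_zero hi hj⟩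
  · have hB : (A *ᵥ v) ᵥ* B = μ • v := by
      rw [← mulVec_transpose, mulVec_mulVec, h]
    rw [kronecker_mul_commMatrix_mulVec_vecM, transpose_vecMulVec, mul_vecMulVec,
      vecMulVec_mul, hB, vecMulVec_smul]
    rfl

theorem exists_mul_eq_sq_of_mem_spectrum_kronecker_mul_commMatrix {m n : ℕ}
    {A B : Matrix (Fin m) (Fin n) ℂ} {μ : ℂ} (hμ : μ ≠ 0)
    (h : μ ∈ spectrum ℂ ((Bᵀ ⊗ₖ A) * commMatrix m n)) :
    ∃ α ∈ spectrum ℂ (Bᵀ * A), ∃ β ∈ spectrum ℂ (Bᵀ * A), α * β = μ ^ 2 := by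
  obtain ⟨v, hv, h⟩ := mem_spectrum_iff_exists_mulVec.1 h
  let X : Matrix (Fin m) (Fin n) ℂ := of fun i j => v (j, i)
  have hvX : v = vecM X := rfl
  have hX : A * Xᵀ * B = μ • X := by
    rw [hvX, kronecker_mul_commMatrix_mulVec_vecM] at h
    ext i j
    exact congrFun h (j, i)
  have hX0 : X ≠ 0 := fun e => hv (by rw [hvX, e]; rfl)
  have hY : Bᵀ * A * (Bᵀ * X)ᵀ = μ • (Bᵀ * X) := by
    rw [← Matrix.mul_smul, ← hX, transpose_mul, transpose_transpose]
    simp only [Matrix.mul_assoc]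
  have hY' : Bᵀ * X * (Bᵀ * A)ᵀ = μ • (Bᵀ * X)ᵀ := by
    simpa only [transpose_mul (Bᵀ * A), transpose_transpose, transpose_smul]
      using congrArg transpose hY
  refine exists_mul_eq_of_mul_mul_transpose_eq_smul (Y := Bᵀ * X) (pow_ne_zero 2 hμ) ?_ ?_
  · intro e
    have e' : Xᵀ * B = 0 := by simpa using congrArg transpose e
    rw [Matrix.mul_assoc, e', Matrix.mul_zero] at hX
    exact smul_ne_zero hμ hX0 hX.symm
  · rw [Matrix.mul_assoc, hY', Matrix.mul_smul, hY, smul_smul, sq]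

/-- For `A, B ∈ ℂ^{m×n}` and `Υ = (Bᵀ ⊗ A) P₍ₘ,ₙ₎`,
`ρ(Υ) = ρ(BᵀA)`. -/
theorem spectralRadius_kronecker_comm {m n : ℕ} (A B : Matrix (Fin m) (Fin n) ℂ) :
    spectralRadius ℂ ((Bᵀ ⊗ₖ A) * commMatrix m n) = spectralRadius ℂ (Bᵀ * A) := by
  apply le_antisymm
  · refine iSup₂_le fun μ h => ?_
    by_cases hμ : μ = 0
    · simp [hμ]
    obtain ⟨α, hα, β, hβ, hαβ⟩ := exists_mul_eq_sq_of_mem_spectrum_kronecker_mul_commMatrix hμ h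
    have hnorm : ‖α‖₊ * ‖β‖₊ = ‖μ‖₊ * ‖μ‖₊ := by rw [← nnnorm_mul, hαβ, sq, nnnorm_mul]
    rcases le_or_gt ‖μ‖₊ ‖α‖₊ with hle | hlt
    · exact le_iSup₂_of_le α hα (by exact_mod_cast hle)
    · refine le_iSup₂_of_le β hβ (ENNReal.coe_le_coe.2 ?_)
      by_contra! hlt'
      exact (mul_lt_mul'' hlt hlt' zero_le zero_le).ne hnorm
  · refine iSup₂_le fun μ h => ?_
    by_cases hμ : μ = 0
    · simp [hμ]
    exact le_iSup₂_of_le μ (mem_spectrum_kronecker_mul_commMatrix hμ h) le_rfl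
end

section
/- Let A, B, C ∈ ℂ^{m×n}. The matrix equation X = AXᵀB + C (unknown X ∈ ℂ^{m×n}) is solvable if and only if the standard Stein equation W = ABᵀWAᵀB + ACᵀB + C (unknown W ∈ ℂ^{m×n}) is solvable. Moreover: (i) every solution X of X = AXᵀB + C satisfies W = X as a solution of the Stein equation; (ii) the map W ↦ (1/2)(W + AWᵀB) + (1/2)C sends every solution of the Stein equation to a solution of X = AXᵀB + C, and every solution of X = AXᵀB + C arises in this way from some solution of the Stein equation. -/
open Matrix

/-- Applying `X ↦ AXᵀB` to `AXᵀB + C`. -/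
theorem mul_transpose_mul_add {m n : Type*} [Fintype m] [Fintype n] {R : Type*}
    [CommSemiring R] (A B C X : Matrix m n R) :
    A * (A * Xᵀ * B + C)ᵀ * B = A * Bᵀ * X * Aᵀ * B + A * Cᵀ * B := by
  simp only [transpose_add, transpose_mul, transpose_transpose, Matrix.mul_add, Matrix.add_mul,
    Matrix.mul_assoc]

/-- Every solution of `X = AXᵀB + C` solves the associated Stein equation. -/
theorem stein_of_eq_AXTB {m n : Type*} [Fintype m] [Fintype n] {R : Type*}
    [CommSemiring R] {A B C X : Matrix m n R} (h : X = A * Xᵀ * B + C) :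
    X = A * Bᵀ * X * Aᵀ * B + A * Cᵀ * B + C := by
  rw [← mul_transpose_mul_add, ← h, ← h]

/-- The average of a Stein solution `W` and `AWᵀB + C` solves `X = AXᵀB + C`. -/
theorem eq_AXTB_of_stein {m n : Type*} [Fintype m] [Fintype n] {K : Type*}
    [Field K] [NeZero (2 : K)] {A B C W : Matrix m n K}
    (h : W = A * Bᵀ * W * Aᵀ * B + A * Cᵀ * B + C) :
    ((1 : K) / 2) • (W + A * Wᵀ * B) + ((1 : K) / 2) • C =
      A * (((1 : K) / 2) • (W + A * Wᵀ * B) + ((1 : K) / 2) • C)ᵀ * B + C := by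
  have hW : A * (A * Wᵀ * B + C)ᵀ * B = W - C := by
    rw [mul_transpose_mul_add]
    exact eq_sub_of_add_eq h.symm
  have h2 : (2 : K) ≠ 0 := NeZero.ne 2
  rw [← smul_add, add_assoc, transpose_smul, Matrix.mul_smul, Matrix.smul_mul, transpose_add,
    Matrix.mul_add, Matrix.add_mul, hW]
  ext i j
  simp only [Matrix.add_apply, Matrix.sub_apply, Matrix.smul_apply, smul_eq_mul]
  field_simp
  ring

/-- `X = AXᵀB + C` is solvable iff the Stein equation
`W = ABᵀWAᵀB + ACᵀB + C` is solvable; every solution of the former solves the latter,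
and `W ↦ ½(W + AWᵀB) + ½C` maps the solution set of the latter onto that of the former. -/
theorem eq_AXTB_iff_stein {m n : ℕ} (A B C : Matrix (Fin m) (Fin n) ℂ) :
    ((∃ X : Matrix (Fin m) (Fin n) ℂ, X = A * Xᵀ * B + C) ↔
      (∃ W : Matrix (Fin m) (Fin n) ℂ, W = A * Bᵀ * W * Aᵀ * B + A * Cᵀ * B + C)) ∧
    (∀ X : Matrix (Fin m) (Fin n) ℂ, X = A * Xᵀ * B + C →
      X = A * Bᵀ * X * Aᵀ * B + A * Cᵀ * B + C) ∧
    (∀ W : Matrix (Fin m) (Fin n) ℂ, W = A * Bᵀ * W * Aᵀ * B + A * Cᵀ * B + C →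
      ((1 : ℂ) / 2) • (W + A * Wᵀ * B) + ((1 : ℂ) / 2) • C =
        A * (((1 : ℂ) / 2) • (W + A * Wᵀ * B) + ((1 : ℂ) / 2) • C)ᵀ * B + C) ∧
    (∀ X : Matrix (Fin m) (Fin n) ℂ, X = A * Xᵀ * B + C →
      ∃ W : Matrix (Fin m) (Fin n) ℂ, W = A * Bᵀ * W * Aᵀ * B + A * Cᵀ * B + C ∧
        X = ((1 : ℂ) / 2) • (W + A * Wᵀ * B) + ((1 : ℂ) / 2) • C) := by
  refine ⟨⟨fun ⟨X, hX⟩ => ⟨X, stein_of_eq_AXTB hX⟩, fun ⟨_, hW⟩ => ⟨_, eq_AXTB_of_stein hW⟩⟩,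
    fun _ => stein_of_eq_AXTB, fun _ => eq_AXTB_of_stein,
    fun X hX => ⟨X, stein_of_eq_AXTB hX, ?_⟩⟩
  rw [← smul_add, add_assoc, ← hX, ← two_smul ℂ X, smul_smul]
  norm_num
end

section
/- Let A, B, C ∈ ℂ^{m×n}, and let α₀, α₁, …, αₘ (with αₘ = 1) be the coefficients of the characteristic polynomial of ABᵀ, i.e. det(sIₘ − ABᵀ) = Σ_{i=0}^{m} αᵢ sⁱ. Define h(M) = Σ_{i=0}^{m} α_{m−i} Mⁱ for a square matrix M. Then: (1) every solution X of X = AXᵀB + C satisfies X · h(AᵀB) = Σ_{k=1}^{m} Σ_{s=1}^{k} α_k (ABᵀ)^{k−s}(ACᵀB + C)(AᵀB)^{m−s}; (2) if ηγ ≠ 1 for all eigenvalues η, γ of ABᵀ, then h(AᵀB) is invertible and the unique solution of X = AXᵀB + C is X★ = (Σ_{k=1}^{m} Σ_{s=1}^{k} α_k (ABᵀ)^{k−s}(ACᵀB + C)(AᵀB)^{m−s}) · (h(AᵀB))^{−1}. -/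
open Matrix Finset

/-- `hpoly α m M = Σ_{i=0}^{m} α_{m-i} Mⁱ`. -/
noncomputable def hpoly {n : ℕ} (α : ℕ → ℂ) (m : ℕ) (M : Matrix (Fin n) (Fin n) ℂ) :
    Matrix (Fin n) (Fin n) ℂ :=
  ∑ i ∈ Finset.range (m + 1), α (m - i) • M ^ i

/-- `steinSum` is `Σ_{k=1}^{m} Σ_{s=1}^{k} α_k (ABᵀ)^{k−s}(ACᵀB + C)(AᵀB)^{m−s}`. -/
noncomputable def steinSum {m n : ℕ} (α : ℕ → ℂ) (A B C : Matrix (Fin m) (Fin n) ℂ) :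
    Matrix (Fin m) (Fin n) ℂ :=
  ∑ k ∈ Finset.Icc 1 m, ∑ s ∈ Finset.Icc 1 k,
    α k • ((A * Bᵀ) ^ (k - s) * (A * Cᵀ * B + C) * (Aᵀ * B) ^ (m - s))

/-- If `α` lists the coefficients of `s ↦ det (s I - P)`, then `P` is annihilated by the
corresponding polynomial (Cayley–Hamilton). -/
theorem sum_smul_pow_eq_zero_of_det {m : ℕ} (P : Matrix (Fin m) (Fin m) ℂ) (α : ℕ → ℂ)
    (hchar : ∀ s : ℂ, (s • (1 : Matrix (Fin m) (Fin m) ℂ) - P).det =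
      ∑ i ∈ Finset.range (m + 1), α i * s ^ i) :
    ∑ i ∈ Finset.range (m + 1), α i • P ^ i = 0 := by
  have hp : P.charpoly =
      ∑ i ∈ Finset.range (m + 1), Polynomial.C (α i) * Polynomial.X ^ i := by
    refine Polynomial.funext fun s => ?_
    rw [Matrix.eval_charpoly, Matrix.scalar_apply, ← Matrix.smul_one_eq_diagonal, hchar,
      Polynomial.eval_finsetSum]
    simp
  have h := Matrix.aeval_self_charpoly P
  rw [hp, map_sum] at h
  simpa [Algebra.smul_def] using h

/-- Telescoping the fixed-point equation `X = P X Q + D`. -/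
theorem eq_pow_mul_mul_pow_add_sum {m n : ℕ} {P : Matrix (Fin m) (Fin m) ℂ}
    {Q : Matrix (Fin n) (Fin n) ℂ} {X D : Matrix (Fin m) (Fin n) ℂ}
    (h : X = P * X * Q + D) (k : ℕ) :
    X = P ^ k * X * Q ^ k + ∑ j ∈ Finset.range k, P ^ j * D * Q ^ j := by
  induction k with
  | zero => simp
  | succ k ih =>
    have h' : P ^ k * X * Q ^ k = P ^ (k + 1) * X * Q ^ (k + 1) + P ^ k * D * Q ^ k := by
      conv_lhs => rw [h]
      rw [Matrix.mul_add, Matrix.add_mul, pow_succ P, pow_succ' Q]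
      simp only [Matrix.mul_assoc]
    conv_lhs => rw [ih, h']
    rw [Finset.sum_range_succ]
    abel

theorem mul_pow_sub_eq {m n : ℕ} {P : Matrix (Fin m) (Fin m) ℂ}
    {Q : Matrix (Fin n) (Fin n) ℂ} {X D : Matrix (Fin m) (Fin n) ℂ}
    (h : X = P * X * Q + D) {k N : ℕ} (hk : k ≤ N) :
    X * Q ^ (N - k) =
      P ^ k * X * Q ^ N + ∑ s ∈ Finset.Icc 1 k, P ^ (k - s) * D * Q ^ (N - s) := by
  conv_lhs => rw [eq_pow_mul_mul_pow_add_sum h k]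
  rw [Matrix.add_mul, Matrix.mul_assoc _ (Q ^ k), ← pow_add, Nat.add_sub_cancel' hk,
    Matrix.sum_mul]
  congr 1
  refine Finset.sum_nbij' (fun j => k - j) (fun s => k - s) ?_ ?_ ?_ ?_ ?_
  · intro j hj
    simp only [Finset.mem_range, Finset.mem_Icc] at *
    omega
  · intro j hj
    simp only [Finset.mem_range, Finset.mem_Icc] at *
    omega
  · intro j hj
    simp only [Finset.mem_range] at *
    omega
  · intro j hj
    simp only [Finset.mem_Icc] at *
    omega
  · intro j hj
    simp only [Finset.mem_range] at hj
    rw [Matrix.mul_assoc _ (Q ^ j), ← pow_add, show k - (k - j) = j by omega,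
      show j + (N - k) = N - (k - j) by omega]

theorem mul_hpoly_eq_steinSum {m n : ℕ} {A B C X : Matrix (Fin m) (Fin n) ℂ} {α : ℕ → ℂ}
    (hchar : ∀ s : ℂ, (s • (1 : Matrix (Fin m) (Fin m) ℂ) - A * Bᵀ).det =
      ∑ i ∈ Finset.range (m + 1), α i * s ^ i)
    (hX : X = A * Xᵀ * B + C) :
    X * hpoly α m (Aᵀ * B) = steinSum α A B C := by
  have hX2 : X = (A * Bᵀ) * X * (Aᵀ * B) + (A * Cᵀ * B + C) := by
    have hT : Xᵀ = Bᵀ * X * Aᵀ + Cᵀ := by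
      conv_lhs => rw [hX]
      simp [Matrix.mul_assoc]
    conv_lhs => rw [hX, hT]
    simp only [Matrix.mul_add, Matrix.add_mul, Matrix.mul_assoc, add_assoc]
  have hrefl : hpoly α m (Aᵀ * B) =
      ∑ k ∈ Finset.range (m + 1), α k • (Aᵀ * B) ^ (m - k) := by
    rw [hpoly, ← Finset.sum_range_reflect]
    refine Finset.sum_congr rfl fun k hk => ?_
    rw [Finset.mem_range] at hk
    rw [show m + 1 - 1 - k = m - k by omega, show m - (m - k) = k by omega]
  have hCH := sum_smul_pow_eq_zero_of_det (A * Bᵀ) α hchar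
  calc X * hpoly α m (Aᵀ * B)
      = ∑ k ∈ Finset.range (m + 1), (α k • ((A * Bᵀ) ^ k * X * (Aᵀ * B) ^ m) +
          ∑ s ∈ Finset.Icc 1 k, α k •
            ((A * Bᵀ) ^ (k - s) * (A * Cᵀ * B + C) * (Aᵀ * B) ^ (m - s))) := by
        rw [hrefl, Matrix.mul_sum]
        refine Finset.sum_congr rfl fun k hk => ?_
        rw [Matrix.mul_smul, mul_pow_sub_eq hX2 (Nat.lt_succ_iff.mp (Finset.mem_range.mp hk)),
          smul_add, Finset.smul_sum]
    _ = (∑ k ∈ Finset.range (m + 1), α k • (A * Bᵀ) ^ k) * X * (Aᵀ * B) ^ m +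
          steinSum α A B C := by
        rw [Finset.sum_add_distrib]
        congr 1
        · simp only [Matrix.sum_mul, Matrix.smul_mul]
        · rw [steinSum]
          symm
          refine Finset.sum_subset (fun k hk => ?_) fun k hk hk' => ?_
          · simp only [Finset.mem_range, Finset.mem_Icc] at *
            omega
          · simp only [Finset.mem_range, Finset.mem_Icc] at *
            rw [Finset.Icc_eq_empty (by omega), Finset.sum_empty]
    _ = steinSum α A B C := by simp [hCH]

theorem mem_spectrum_iff_det_eq_zero {m : ℕ} (P : Matrix (Fin m) (Fin m) ℂ) (s : ℂ) :
    s ∈ spectrum ℂ P ↔ (s • (1 : Matrix (Fin m) (Fin m) ℂ) - P).det = 0 := by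
  rw [spectrum.mem_iff, Matrix.isUnit_iff_isUnit_det, isUnit_iff_ne_zero, not_not,
    Algebra.algebraMap_eq_smul_one]

/-- Nonzero eigenvalues of `AᵀB` are eigenvalues of `ABᵀ`. -/
theorem mem_spectrum_mul_transpose {m n : ℕ} {A B : Matrix (Fin m) (Fin n) ℂ} {γ : ℂ}
    (hγ : γ ≠ 0) (h : γ ∈ spectrum ℂ (Aᵀ * B)) : γ ∈ spectrum ℂ (A * Bᵀ) := by
  have key : ∀ {l : ℕ} (M : Matrix (Fin l) (Fin l) ℂ),
      γ ∈ spectrum ℂ M ↔ (1 - γ⁻¹ • M).det = 0 := by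
    intro l M
    have : γ • (1 : Matrix (Fin l) (Fin l) ℂ) - M = γ • (1 - γ⁻¹ • M) := by
      rw [smul_sub, smul_inv_smul₀ hγ]
    rw [mem_spectrum_iff_det_eq_zero, this, Matrix.det_smul, mul_eq_zero,
      or_iff_right (pow_ne_zero _ hγ)]
  rw [key] at h ⊢
  rw [← Matrix.det_transpose]
  have e : (1 - γ⁻¹ • (A * Bᵀ))ᵀ = 1 - B * (γ⁻¹ • Aᵀ) := by simp
  rw [e, Matrix.det_one_sub_mul_comm, Matrix.smul_mul, h]

theorem isUnit_hpoly {m n : ℕ} {A B : Matrix (Fin m) (Fin n) ℂ} {α : ℕ → ℂ} (hαm : α m = 1)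
    (hchar : ∀ s : ℂ, (s • (1 : Matrix (Fin m) (Fin m) ℂ) - A * Bᵀ).det =
      ∑ i ∈ Finset.range (m + 1), α i * s ^ i)
    (hne : ∀ η ∈ spectrum ℂ (A * Bᵀ), ∀ γ ∈ spectrum ℂ (A * Bᵀ), η * γ ≠ 1) :
    IsUnit (hpoly α m (Aᵀ * B)) := by
  rcases Nat.eq_zero_or_pos n with rfl | hn
  · exact isUnit_of_subsingleton _
  have : Nonempty (Fin n) := ⟨⟨0, hn⟩⟩
  set H : Polynomial ℂ :=
    ∑ i ∈ Finset.range (m + 1), Polynomial.C (α (m - i)) * Polynomial.X ^ i with hH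
  have hev : ∀ z : ℂ, H.eval z = ∑ i ∈ Finset.range (m + 1), α (m - i) * z ^ i := by
    intro z
    rw [hH, Polynomial.eval_finsetSum]
    simp
  have hae : hpoly α m (Aᵀ * B) = Polynomial.aeval (Aᵀ * B) H := by
    rw [hH, map_sum, hpoly]
    simp [Algebra.smul_def]
  rw [hae]
  by_contra hu
  have h0 : (0 : ℂ) ∈ spectrum ℂ (Polynomial.aeval (Aᵀ * B) H) :=
    (spectrum.zero_mem_iff ℂ).mpr hu
  rw [spectrum.map_polynomial_aeval_of_nonempty _ _
    (spectrum.nonempty_of_isAlgClosed_of_finiteDimensional ℂ _)] at h0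
  obtain ⟨γ, hγ, hz⟩ := h0
  simp only [hev] at hz
  have hγ0 : γ ≠ 0 := by
    rintro rfl
    rw [Finset.sum_range_succ'] at hz
    simp [hαm] at hz
  refine hne γ⁻¹ ?_ γ (mem_spectrum_mul_transpose hγ0 hγ) (inv_mul_cancel₀ hγ0)
  rw [mem_spectrum_iff_det_eq_zero, hchar]
  have hmul : γ ^ m * ∑ i ∈ Finset.range (m + 1), α i * γ⁻¹ ^ i = 0 := by
    rw [← hz, Finset.mul_sum, ← Finset.sum_range_reflect]
    refine Finset.sum_congr rfl fun i hi => ?_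
    rw [Finset.mem_range] at hi
    obtain ⟨j, rfl⟩ : ∃ j, m = i + j := ⟨m - i, by omega⟩
    rw [show i + j + 1 - 1 - i = j by omega, show i + j - i = j by omega, pow_add, inv_pow]
    field_simp
  exact (mul_eq_zero.mp hmul).resolve_left (pow_ne_zero _ hγ0)

/-- If the homogeneous equation `X = A Xᵀ B` has only the trivial solution, then
`X = A Xᵀ B + C` is solvable. -/
theorem exists_eq_mul_transpose_mul_add {m n : ℕ} (A B C : Matrix (Fin m) (Fin n) ℂ)
    (h : ∀ X : Matrix (Fin m) (Fin n) ℂ, X = A * Xᵀ * B → X = 0) :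
    ∃ X : Matrix (Fin m) (Fin n) ℂ, X = A * Xᵀ * B + C := by
  let L : Matrix (Fin m) (Fin n) ℂ →ₗ[ℂ] Matrix (Fin m) (Fin n) ℂ :=
    { toFun := fun X => X - A * Xᵀ * B
      map_add' := fun X Y => by
        rw [Matrix.transpose_add, Matrix.mul_add, Matrix.add_mul]
        abel
      map_smul' := fun c X => by simp [smul_sub] }
  have hinj : Function.Injective L :=
    (injective_iff_map_eq_zero L).mpr fun X hX => h X (sub_eq_zero.mp hX)
  obtain ⟨X, hX⟩ := LinearMap.injective_iff_surjective.mp hinj C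
  exact ⟨X, (sub_eq_iff_eq_add'.mp hX)⟩

/-- Closed-form solutions of `X = AXᵀB + C` in terms of the
characteristic polynomial coefficients of `ABᵀ`. -/
theorem eq_AXTB_closed_form {m n : ℕ} (A B C : Matrix (Fin m) (Fin n) ℂ)
    (α : ℕ → ℂ) (hαm : α m = 1)
    (hchar : ∀ s : ℂ, (s • (1 : Matrix (Fin m) (Fin m) ℂ) - A * Bᵀ).det =
      ∑ i ∈ Finset.range (m + 1), α i * s ^ i) :
    (∀ X : Matrix (Fin m) (Fin n) ℂ, X = A * Xᵀ * B + C →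
      X * hpoly α m (Aᵀ * B) = steinSum α A B C) ∧
    ((∀ η ∈ spectrum ℂ (A * Bᵀ), ∀ γ ∈ spectrum ℂ (A * Bᵀ), η * γ ≠ 1) →
      IsUnit (hpoly α m (Aᵀ * B)) ∧
      steinSum α A B C * (hpoly α m (Aᵀ * B))⁻¹ =
        A * (steinSum α A B C * (hpoly α m (Aᵀ * B))⁻¹)ᵀ * B + C ∧
      ∀ X : Matrix (Fin m) (Fin n) ℂ, X = A * Xᵀ * B + C →
        X = steinSum α A B C * (hpoly α m (Aᵀ * B))⁻¹) := by
  refine ⟨fun X hX => mul_hpoly_eq_steinSum hchar hX, fun hne => ?_⟩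
  have hu := isUnit_hpoly hαm hchar hne
  have hdet := (Matrix.isUnit_iff_isUnit_det _).mp hu
  have huniq : ∀ X : Matrix (Fin m) (Fin n) ℂ, X = A * Xᵀ * B + C →
      X = steinSum α A B C * (hpoly α m (Aᵀ * B))⁻¹ := fun X hX => by
    rw [← mul_hpoly_eq_steinSum hchar hX, Matrix.mul_nonsing_inv_cancel_right _ _ hdet]
  refine ⟨hu, ?_, huniq⟩
  obtain ⟨X, hX⟩ := exists_eq_mul_transpose_mul_add A B C fun X hX => by
    have h := mul_hpoly_eq_steinSum (C := 0) hchar (by rwa [add_zero])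
    rw [← Matrix.mul_nonsing_inv_cancel_right _ X hdet, h]
    simp [steinSum]
  rwa [← huniq X hX]
end

section
/- Let A, B, C ∈ ℂ^{m×n} and assume the equation X = AXᵀB + C has a unique solution X★ ∈ ℂ^{m×n}. Then the Smith iteration X_{k+1} = AX_kᵀB + C converges to X★ for every initial matrix X₀ ∈ ℂ^{m×n} if and only if ρ(BᵀA) < 1. -/
open Matrix Filter

/-- In a complex Banach algebra, the powers of an element of spectral radius less than one tend
to zero. -/
theorem tendsto_pow_atTop_nhds_zero_of_spectralRadius_lt_one {R : Type*} [NormedRing R]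
    [NormedAlgebra ℂ R] [CompleteSpace R] {a : R} (ha : spectralRadius ℂ a < 1) :
    Tendsto (fun k : ℕ => a ^ k) atTop (nhds 0) := by
  obtain ⟨r, har, hr⟩ := ENNReal.lt_iff_exists_nnreal_btwn.mp ha
  have hr' : (r : ℝ) < 1 := by exact_mod_cast hr
  refine squeeze_zero_norm' ?_ (tendsto_pow_atTop_nhds_zero_of_lt_one r.coe_nonneg hr')
  filter_upwards [(spectrum.pow_nnnorm_pow_one_div_tendsto_nhds_spectralRadius a).eventually_lt_const
    har, eventually_gt_atTop 0] with k hk hk0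
  have hk0' : (0 : ℝ) < k := by exact_mod_cast hk0
  rw [one_div, ENNReal.rpow_inv_lt_iff hk0', ENNReal.rpow_natCast] at hk
  exact_mod_cast hk.le

theorem Matrix.tendsto_pow_atTop_nhds_zero_of_spectralRadius_lt_one {ι : Type*} [Fintype ι]
    [DecidableEq ι] {M : Matrix ι ι ℂ} (hM : spectralRadius ℂ M < 1) :
    Tendsto (fun k : ℕ => M ^ k) atTop (nhds 0) := by
  let : NormedRing (Matrix ι ι ℂ) := Matrix.linftyOpNormedRing
  let : NormedAlgebra ℂ (Matrix ι ι ℂ) := Matrix.linftyOpNormedAlgebra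
  exact _root_.tendsto_pow_atTop_nhds_zero_of_spectralRadius_lt_one hM

theorem Matrix.spectralRadius_lt_one {ι : Type*} [Fintype ι] [DecidableEq ι] {M : Matrix ι ι ℂ}
    (hM : ∀ z ∈ spectrum ℂ M, ‖z‖ < 1) : spectralRadius ℂ M < 1 := by
  let : NormedRing (Matrix ι ι ℂ) := Matrix.linftyOpNormedRing
  let : NormedAlgebra ℂ (Matrix ι ι ℂ) := Matrix.linftyOpNormedAlgebra
  cases isEmpty_or_nonempty ι
  · simp
  · exact_mod_cast spectrum.spectralRadius_lt_of_forall_lt M (r := 1) hM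

theorem Matrix.exists_mulVec_eq_smul_of_mem_spectrum {ι K : Type*} [Fintype ι] [DecidableEq ι]
    [Field K] {M : Matrix ι ι K} {z : K} (hz : z ∈ spectrum K M) : ∃ v ≠ 0, M *ᵥ v = z • v := by
  rw [← Matrix.spectrum_toLin', ← Module.End.hasEigenvalue_iff_mem_spectrum] at hz
  obtain ⟨v, hv⟩ := hz.exists_hasEigenvector
  exact ⟨v, hv.2, by simpa using hv.apply_eq_smul⟩

section HomogeneousIteration

variable {m n R : Type*} [Fintype m] [Fintype n] [CommRing R]
  {A B : Matrix m n R}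

/-- A closed form for the iterates of `E ↦ A Eᵀ B`, two steps at a time. -/
theorem iterate_mul_transpose_mul_eq [DecidableEq n] {D : ℕ → Matrix m n R}
    (hD : ∀ k, D (k + 1) = A * (D k)ᵀ * B) (j k : ℕ) :
    D (2 * k + j + 1) = A * (Bᵀ * A) ^ k * (D j)ᵀ * B * ((Bᵀ * A) ^ k)ᵀ := by
  induction k with
  | zero => simp [hD]
  | succ k ih =>
    have h : 2 * (k + 1) + j + 1 = 2 * k + j + 1 + 1 + 1 := by ring
    rw [h, hD, hD, ih, pow_succ' _ k]
    simp only [transpose_mul, transpose_transpose, Matrix.mul_assoc]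

/-- An eigenvector `v` of `Bᵀ A` gives the eigenvector `(A v) vᵀ` of `E ↦ A Eᵀ B`, for the same
eigenvalue. -/
theorem mul_transpose_vecMulVec_mul {v : n → R} {z : R} (hv : (Bᵀ * A) *ᵥ v = z • v) :
    A * (vecMulVec (A *ᵥ v) v)ᵀ * B = z • vecMulVec (A *ᵥ v) v := by
  rw [transpose_vecMulVec, mul_vecMulVec, vecMulVec_mul, ← mulVec_transpose, mulVec_mulVec, hv,
    vecMulVec_smul]

end HomogeneousIteration

/-- If `X = AXᵀB + C` has a unique solution `X★`, then the Smith
iteration `X_{k+1} = A X_kᵀ B + C` converges to `X★` for every initial matrix `X₀` iff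
`ρ(BᵀA) < 1`. -/
theorem smith_iteration_AXTB_converges_iff {m n : ℕ} (A B C : Matrix (Fin m) (Fin n) ℂ)
    (Xs : Matrix (Fin m) (Fin n) ℂ)
    (hsol : Xs = A * Xsᵀ * B + C)
    (huniq : ∀ Y : Matrix (Fin m) (Fin n) ℂ, Y = A * Yᵀ * B + C → Y = Xs) :
    (∀ X : ℕ → Matrix (Fin m) (Fin n) ℂ,
        (∀ k : ℕ, X (k + 1) = A * (X k)ᵀ * B + C) →
        Tendsto X atTop (nhds Xs)) ↔
      spectralRadius ℂ (Bᵀ * A) < 1 := by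
  constructor
  · intro hconv
    refine Matrix.spectralRadius_lt_one fun z hz => ?_
    by_contra! hz1
    obtain ⟨v, hv0, hv⟩ := Matrix.exists_mulVec_eq_smul_of_mem_spectrum hz
    have hz0 : z ≠ 0 := norm_pos_iff.mp (one_pos.trans_le hz1)
    have hAv : A *ᵥ v ≠ 0 := by
      intro h
      rw [← mulVec_mulVec, h, mulVec_zero] at hv
      exact smul_ne_zero hz0 hv0 hv.symm
    have hE := mul_transpose_vecMulVec_mul hv
    obtain ⟨i, hi⟩ := Function.ne_iff.mp hAv
    obtain ⟨j, hj⟩ := Function.ne_iff.mp hv0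
    have hX := hconv (fun k => Xs + z ^ k • vecMulVec (A *ᵥ v) v) fun k => by
      rw [transpose_add, transpose_smul, Matrix.mul_add, Matrix.add_mul, Matrix.mul_smul,
        Matrix.smul_mul, hE, smul_smul, ← pow_succ, add_right_comm, ← hsol]
    have hij := (tendsto_pi_nhds.mp (tendsto_pi_nhds.mp hX i) j).sub_const (Xs i j)
    have hc : (A *ᵥ v) i * v j ≠ 0 := mul_ne_zero hi hj
    have hzk : Tendsto (fun k : ℕ => z ^ k) atTop (nhds 0) := by
      simp only [Matrix.add_apply, Matrix.smul_apply, vecMulVec_apply, smul_eq_mul,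
        add_sub_cancel_left, sub_self] at hij
      simpa only [mul_inv_cancel_right₀ hc, zero_mul] using
        hij.mul_const ((A *ᵥ v) i * v j)⁻¹
    exact hz1.not_gt (tendsto_pow_atTop_nhds_zero_iff_norm_lt_one.mp hzk)
  · intro hρ X hX
    have hD (k : ℕ) : X (k + 1) - Xs = A * (X k - Xs)ᵀ * B := by
      rw [transpose_sub, Matrix.mul_sub, Matrix.sub_mul, hX]
      nth_rewrite 1 [hsol]
      abel
    have hpow := Matrix.tendsto_pow_atTop_nhds_zero_of_spectralRadius_lt_one hρ
    have hsub (j : ℕ) : Tendsto (fun k => X (2 * k + j + 1) - Xs) atTop (nhds 0) := by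
      simp only [iterate_mul_transpose_mul_eq (D := fun k => X k - Xs) hD j]
      have hcont : Continuous fun P : Matrix (Fin n) (Fin n) ℂ =>
          A * P * (X j - Xs)ᵀ * B * Pᵀ := by fun_prop
      have h := (hcont.tendsto 0).comp hpow
      rwa [Matrix.mul_zero, Matrix.zero_mul, Matrix.zero_mul, Matrix.zero_mul] at h
    rw [← tendsto_add_atTop_iff_nat 1, ← tendsto_sub_nhds_zero_iff]
    intro s hs
    change ∀ᶠ k in atTop, X (k + 1) - Xs ∈ s
    filter_upwards [(Nat.tendsto_div_const_atTop two_ne_zero).eventually (hsub 0 hs),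
      (Nat.tendsto_div_const_atTop two_ne_zero).eventually (hsub 1 hs)] with k h0 h1
    rcases Nat.mod_two_eq_zero_or_one k with h | h
    · rwa [show 2 * (k / 2) + 0 = k by lia] at h0
    · rwa [show 2 * (k / 2) + 1 = k by lia] at h1
end

section
/- Let A = A₁ + iA₂ ∈ ℂ^{m×m} with A₁, A₂ real. Then (1) rank(A_σ) = 2·rank(A), and (2) rank(I_{2m} − A_σ) = m + rank(Iₘ − AĀ). -/
open Matrix

/-- Real part of a complex matrix, as a complex matrix. -/
def reM {m n : ℕ} (A : Matrix (Fin m) (Fin n) ℂ) : Matrix (Fin m) (Fin n) ℂ :=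
  A.map fun z => (z.re : ℂ)

/-- Imaginary part of a complex matrix, as a complex matrix. -/
def imM {m n : ℕ} (A : Matrix (Fin m) (Fin n) ℂ) : Matrix (Fin m) (Fin n) ℂ :=
  A.map fun z => (z.im : ℂ)

/-- Entrywise complex conjugate. -/
def conjM {m n : ℕ} (A : Matrix (Fin m) (Fin n) ℂ) : Matrix (Fin m) (Fin n) ℂ :=
  A.map (starRingEnd ℂ)

/-- The real representation `A_σ = [[A₁, A₂], [A₂, −A₁]]` of `A = A₁ + iA₂`. -/
def sigmaM {m n : ℕ} (A : Matrix (Fin m) (Fin n) ℂ) :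
    Matrix (Fin m ⊕ Fin m) (Fin n ⊕ Fin n) ℂ :=
  Matrix.fromBlocks (reM A) (imM A) (imM A) (-reM A)

/-- The rank of a block diagonal matrix is the sum of the ranks of its blocks. -/
theorem rank_fromBlocks_zero_zero {K l m n o : Type*} [Field K] [Fintype l] [Fintype m] [Finite n]
    [Finite o] (A : Matrix n l K) (D : Matrix o m K) :
    (fromBlocks A 0 0 D).rank = A.rank + D.rank := by
  rw [rank, rank, rank, ← Module.finrank_prod]
  refine LinearEquiv.finrank_eq
    { toFun := fun y => (⟨fun i => y.1 (Sum.inl i), ?_⟩, ⟨fun i => y.1 (Sum.inr i), ?_⟩)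
      invFun := fun p => ⟨Sum.elim p.1.1 p.2.1, ?_⟩
      map_add' := fun _ _ => rfl
      map_smul' := fun _ _ => rfl
      left_inv := fun y => Subtype.ext (Sum.elim_comp_inl_inr y.1)
      right_inv := fun _ => rfl }
  · obtain ⟨x, hx⟩ := y.2
    exact ⟨x ∘ Sum.inl, by rw [← hx]; ext i; simp [fromBlocks_mulVec]⟩
  · obtain ⟨x, hx⟩ := y.2
    exact ⟨x ∘ Sum.inr, by rw [← hx]; ext i; simp [fromBlocks_mulVec]⟩
  · obtain ⟨⟨_, x, rfl⟩, ⟨_, y, rfl⟩⟩ := p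
    exact ⟨Sum.elim x y, by simp [fromBlocks_mulVec]⟩

/-- Rank form of the Schur complement formula for a block matrix with unit diagonal blocks. -/
theorem rank_fromBlocks_one_neg_neg_one {K m n : Type*} [Field K] [Fintype m] [Fintype n]
    [DecidableEq m] [DecidableEq n] (A : Matrix n m K) (B : Matrix m n K) :
    (fromBlocks 1 (-B) (-A) 1).rank = Fintype.card m + (1 - A * B).rank := by
  have h : fromBlocks 1 (-B) (-A) 1 =
      fromBlocks 1 0 (-A) 1 * (fromBlocks 1 0 0 (1 - A * B) * fromBlocks 1 (-B) 0 1) := by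
    simp [fromBlocks_multiply]
  rw [h, rank_mul_eq_right_of_isUnit_det _ _ (by simp),
    rank_mul_eq_left_of_isUnit_det _ _ (by simp), rank_fromBlocks_zero_zero, rank_one]

open scoped ComplexOrder in
theorem rank_conjM {m n : ℕ} (A : Matrix (Fin m) (Fin n) ℂ) : (conjM A).rank = A.rank := by
  rw [← rank_conjTranspose A, ← rank_transpose Aᴴ]
  rfl

/-- Intertwines `sigmaM A` with the antidiagonal block matrix of `A` and its conjugate. -/
def sigmaConj (m : ℕ) : Matrix (Fin m ⊕ Fin m) (Fin m ⊕ Fin m) ℂ :=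
  fromBlocks 1 1 (Complex.I • 1) (-Complex.I • 1)

theorem isUnit_det_sigmaConj (m : ℕ) : IsUnit (sigmaConj m).det := by
  rw [sigmaConj, det_fromBlocks_one₁₁, Matrix.mul_one, ← sub_smul, det_smul, det_one, mul_one]
  refine IsUnit.pow _ (isUnit_iff_ne_zero.mpr fun h => Complex.I_ne_zero ?_)
  linear_combination (-1 / 2 : ℂ) * h

theorem sigmaM_mul_sigmaConj {m n : ℕ} (A : Matrix (Fin m) (Fin n) ℂ) :
    sigmaM A * sigmaConj n = sigmaConj m * fromBlocks 0 (conjM A) A 0 := by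
  have h : fromBlocks 0 (conjM A) A 0 = fromBlocks 0 (reM A - Complex.I • imM A)
      (reM A + Complex.I • imM A) 0 := by
    congr 1 <;> ext i j <;> simp [conjM, reM, imM, Complex.ext_iff]
  rw [h, sigmaM, sigmaConj, sigmaConj]
  simp [fromBlocks_multiply, smul_smul, smul_add, sub_eq_add_neg, add_comm]

/-- `rank(A_σ) = 2·rank(A)` and
`rank(I_{2m} − A_σ) = m + rank(Iₘ − AĀ)`. -/
theorem rank_sigma {m : ℕ} (A : Matrix (Fin m) (Fin m) ℂ) :
    (sigmaM A).rank = 2 * A.rank ∧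
    (1 - sigmaM A).rank = m + (1 - A * conjM A).rank := by
  constructor
  · rw [← rank_mul_eq_left_of_isUnit_det _ (sigmaM A) (isUnit_det_sigmaConj m),
      sigmaM_mul_sigmaConj, rank_mul_eq_right_of_isUnit_det _ _ (isUnit_det_sigmaConj m),
      ← rank_submatrix _ (Equiv.sumComm _ _) (Equiv.refl _)]
    simp only [Equiv.sumComm_apply, Equiv.coe_refl, fromBlocks_submatrix_sum_swap_left,
      submatrix_id_id]
    rw [rank_fromBlocks_zero_zero, rank_conjM, two_mul]
  · have h : (1 - sigmaM A) * sigmaConj m =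
        sigmaConj m * fromBlocks 1 (-conjM A) (-A) 1 := by
      rw [Matrix.sub_mul, sigmaM_mul_sigmaConj, Matrix.one_mul, sub_eq_add_neg, ← Matrix.mul_neg]
      nth_rewrite 1 [← Matrix.mul_one (sigmaConj m)]
      rw [← Matrix.mul_add, ← fromBlocks_one, fromBlocks_neg, fromBlocks_add]
      simp
    rw [← rank_mul_eq_left_of_isUnit_det _ (1 - sigmaM A) (isUnit_det_sigmaConj m), h,
      rank_mul_eq_right_of_isUnit_det _ _ (isUnit_det_sigmaConj m),
      rank_fromBlocks_one_neg_neg_one, Fintype.card_fin]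
end

section
/- Let A ∈ ℂ^{m×m} and B ∈ ℂ^{n×n}. The matrix equation X = AX̄B + C (unknown X ∈ ℂ^{m×n}) has a unique solution for every C ∈ ℂ^{m×n} if and only if ηγ ≠ 1 for all eigenvalues η of AĀ and all eigenvalues γ of B̄B. -/
open Matrix

/-- A nonzero fixed point of `Y ↦ P * Y * Q` yields eigenvalues of `P` and `Q` with product `1`. -/
theorem exists_spectrum_mul_eq_one_of_mul_mul_eq_self {m n : ℕ}
    {P : Matrix (Fin m) (Fin m) ℂ} {Q : Matrix (Fin n) (Fin n) ℂ}
    {Y : Matrix (Fin m) (Fin n) ℂ} (hY : Y ≠ 0) (h : P * Y * Q = Y) :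
    ∃ η ∈ spectrum ℂ P, ∃ γ ∈ spectrum ℂ Q, η * γ = 1 := by
  let V : Submodule ℂ (Matrix (Fin m) (Fin n) ℂ) :=
    { carrier := {Z | P * Z * Q = Z}
      add_mem' := by
        intro a b (ha : _ = _) (hb : _ = _)
        change P * (a + b) * Q = a + b
        rw [Matrix.mul_add, Matrix.add_mul, ha, hb]
      zero_mem' := by simp
      smul_mem' := by
        intro c a (ha : _ = _)
        change P * (c • a) * Q = c • a
        rw [Matrix.mul_smul, Matrix.smul_mul, ha] }
  let f : Module.End ℂ V :=
    { toFun := fun Z => ⟨P * Z.1, by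
        change P * (P * Z.1) * Q = P * Z.1
        have hZ : P * Z.1 * Q = Z.1 := Z.2
        rw [Matrix.mul_assoc P, hZ]⟩
      map_add' := fun a b => Subtype.ext (Matrix.mul_add P a.1 b.1)
      map_smul' := fun c a => Subtype.ext (Matrix.mul_smul P c a.1) }
  have : Nontrivial V := ⟨⟨Y, h⟩, 0, fun h0 => hY (congrArg Subtype.val h0)⟩
  obtain ⟨η, hη⟩ := Module.End.exists_eigenvalue f
  obtain ⟨Z, hZ⟩ := hη.exists_hasEigenvector
  have hZ0 : Z.1 ≠ 0 := fun h0 => hZ.2 (Subtype.ext h0)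
  have hPZ : P * Z.1 = η • Z.1 := congrArg Subtype.val hZ.apply_eq_smul
  have hfix : η • (Z.1 * Q) = Z.1 := by
    rw [← Matrix.smul_mul, ← hPZ]
    exact Z.2
  have hη0 : η ≠ 0 := by
    rintro rfl
    exact hZ0 (by rw [← hfix, zero_smul])
  have hZQ : Z.1 * Q = η⁻¹ • Z.1 := by
    rw [eq_inv_smul_iff₀ hη0, hfix]
  refine ⟨η, ?_, η⁻¹, ?_, mul_inv_cancel₀ hη0⟩
  · rw [spectrum.mem_iff, Algebra.algebraMap_eq_smul_one]
    rintro ⟨u, hu⟩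
    refine hZ0 ?_
    calc Z.1 = ((u⁻¹).val * u.val) * Z.1 := by rw [Units.inv_mul, Matrix.one_mul]
      _ = 0 := by
        rw [Matrix.mul_assoc, hu, Matrix.sub_mul, hPZ, Matrix.smul_mul, Matrix.one_mul,
          sub_self, Matrix.mul_zero]
  · rw [spectrum.mem_iff, Algebra.algebraMap_eq_smul_one]
    rintro ⟨u, hu⟩
    refine hZ0 ?_
    calc Z.1 = Z.1 * (u.val * (u⁻¹).val) := by rw [Units.mul_inv, Matrix.mul_one]
      _ = 0 := by
        rw [← Matrix.mul_assoc, hu, Matrix.mul_sub, hZQ, Matrix.mul_smul, Matrix.mul_one,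
          sub_self, Matrix.zero_mul]

/-- Eigenvalues of `P` and `Q` with product `1` yield a nonzero fixed point of
`Y ↦ P * Y * Q`. -/
theorem exists_mul_mul_eq_self_of_spectrum_mul_eq_one {m n : ℕ}
    {P : Matrix (Fin m) (Fin m) ℂ} {Q : Matrix (Fin n) (Fin n) ℂ} {η γ : ℂ}
    (hη : η ∈ spectrum ℂ P) (hγ : γ ∈ spectrum ℂ Q) (h : η * γ = 1) :
    ∃ Y : Matrix (Fin m) (Fin n) ℂ, Y ≠ 0 ∧ P * Y * Q = Y := by
  rw [spectrum.mem_iff, Matrix.isUnit_iff_isUnit_det, isUnit_iff_ne_zero, not_not,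
    Algebra.algebraMap_eq_smul_one] at hη hγ
  obtain ⟨v, hv0, hv⟩ := Matrix.exists_mulVec_eq_zero_iff.mpr hη
  obtain ⟨w, hw0, hw⟩ := Matrix.exists_vecMul_eq_zero_iff.mpr hγ
  rw [Matrix.sub_mulVec, Matrix.smul_mulVec, Matrix.one_mulVec, sub_eq_zero] at hv
  rw [Matrix.vecMul_sub, Matrix.vecMul_smul, Matrix.vecMul_one, sub_eq_zero] at hw
  refine ⟨Matrix.vecMulVec v w, ?_, ?_⟩
  · obtain ⟨i, hi⟩ := Function.ne_iff.mp hv0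
    obtain ⟨j, hj⟩ := Function.ne_iff.mp hw0
    exact fun h0 => mul_ne_zero hi hj (congrFun (congrFun h0 i) j)
  · rw [Matrix.mul_vecMulVec, Matrix.vecMulVec_mul, ← hv, ← hw, Matrix.smul_vecMulVec,
      Matrix.vecMulVec_smul, smul_smul, h, one_smul]

theorem conjM_add {m n : ℕ} (X Y : Matrix (Fin m) (Fin n) ℂ) :
    conjM (X + Y) = conjM X + conjM Y :=
  Matrix.map_add _ (map_add _) X Y

theorem conjM_sub {m n : ℕ} (X Y : Matrix (Fin m) (Fin n) ℂ) :
    conjM (X - Y) = conjM X - conjM Y :=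
  Matrix.map_sub _ (map_sub _) X Y

theorem conjM_mul {l m n : ℕ} (X : Matrix (Fin l) (Fin m) ℂ) (Y : Matrix (Fin m) (Fin n) ℂ) :
    conjM (X * Y) = conjM X * conjM Y :=
  Matrix.map_mul

theorem conjM_conjM {m n : ℕ} (X : Matrix (Fin m) (Fin n) ℂ) : conjM (conjM X) = X := by
  ext i j
  simp [conjM]

theorem conjM_smul {m n : ℕ} (c : ℂ) (X : Matrix (Fin m) (Fin n) ℂ) :
    conjM (c • X) = starRingEnd ℂ c • conjM X := by
  ext i j
  simp [conjM]

/-- Applying `X ↦ A * conjM X * B` twice is the `ℂ`-linear map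
`X ↦ (A * conjM A) * X * (conjM B * B)`. -/
theorem mul_conjM_mul_conjM_mul {m n : ℕ} (A : Matrix (Fin m) (Fin m) ℂ)
    (B : Matrix (Fin n) (Fin n) ℂ) (X : Matrix (Fin m) (Fin n) ℂ) :
    A * conjM (A * conjM X * B) * B = A * conjM A * X * (conjM B * B) := by
  simp only [conjM_mul, conjM_conjM, Matrix.mul_assoc]

/-- A nonzero fixed point of the square of `X ↦ A * conjM X * B` yields a nonzero fixed point
of the map itself. -/
theorem exists_mul_conjM_mul_eq_self {m n : ℕ} {A : Matrix (Fin m) (Fin m) ℂ}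
    {B : Matrix (Fin n) (Fin n) ℂ} {Y : Matrix (Fin m) (Fin n) ℂ} (hY : Y ≠ 0)
    (h : A * conjM A * Y * (conjM B * B) = Y) :
    ∃ Z : Matrix (Fin m) (Fin n) ℂ, Z ≠ 0 ∧ A * conjM Z * B = Z := by
  by_cases hZ : Y + A * conjM Y * B = 0
  · refine ⟨Complex.I • Y, smul_ne_zero Complex.I_ne_zero hY, ?_⟩
    rw [conjM_smul, Matrix.mul_smul, Matrix.smul_mul, eq_neg_of_add_eq_zero_right hZ,
      Complex.conj_I, smul_neg, neg_smul, neg_neg]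
  · refine ⟨_, hZ, ?_⟩
    rw [conjM_add, Matrix.mul_add, Matrix.add_mul, mul_conjM_mul_conjM_mul, h, add_comm]

/-- `X = AX̄B + C` has a unique solution for every `C` iff `ηγ ≠ 1`
for all eigenvalues `η` of `AĀ` and `γ` of `B̄B`. -/
theorem eq_AconjXB_unique_iff {m n : ℕ}
    (A : Matrix (Fin m) (Fin m) ℂ) (B : Matrix (Fin n) (Fin n) ℂ) :
    (∀ C : Matrix (Fin m) (Fin n) ℂ,
        ∃! X : Matrix (Fin m) (Fin n) ℂ, X = A * conjM X * B + C) ↔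
      ∀ η ∈ spectrum ℂ (A * conjM A), ∀ γ ∈ spectrum ℂ (conjM B * B), η * γ ≠ 1 := by
  constructor
  · intro h η hη γ hγ hηγ
    obtain ⟨Y, hY, hfix⟩ := exists_mul_mul_eq_self_of_spectrum_mul_eq_one hη hγ hηγ
    obtain ⟨Z, hZ, hZfix⟩ := exists_mul_conjM_mul_eq_self hY hfix
    refine hZ ((h 0).unique ?_ ?_)
    · rw [hZfix, add_zero]
    · ext i j
      simp [conjM]
  · intro h C
    let L : Module.End ℂ (Matrix (Fin m) (Fin n) ℂ) :=
      { toFun := fun X => X - A * conjM A * X * (conjM B * B)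
        map_add' := fun X Y => by
          rw [Matrix.mul_add, Matrix.add_mul]
          abel
        map_smul' := fun c X => by
          rw [Matrix.mul_smul, Matrix.smul_mul, RingHom.id_apply, smul_sub] }
    have hfix : ∀ Y : Matrix (Fin m) (Fin n) ℂ,
        A * conjM A * Y * (conjM B * B) = Y → Y = 0 := by
      intro Y hYfix
      by_contra hY
      obtain ⟨η, hη, γ, hγ, hηγ⟩ := exists_spectrum_mul_eq_one_of_mul_mul_eq_self hY hYfix
      exact h η hη γ hγ hηγ
    have hL : Function.Injective L :=
      (injective_iff_map_eq_zero L).mpr fun Y hY => hfix Y (sub_eq_zero.mp hY).symm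
    obtain ⟨W, hW⟩ := LinearMap.injective_iff_surjective.mp hL C
    change W - A * conjM A * W * (conjM B * B) = C at hW
    refine ⟨W + A * conjM W * B, ?_, fun X hX => ?_⟩
    · change W + A * conjM W * B = A * conjM (W + A * conjM W * B) * B + C
      rw [conjM_add, Matrix.mul_add, Matrix.add_mul, mul_conjM_mul_conjM_mul, ← hW]
      abel
    · have hD : A * conjM (X - (W + A * conjM W * B)) * B = X - (W + A * conjM W * B) := by
        rw [conjM_sub, conjM_add, Matrix.mul_sub, Matrix.mul_add, Matrix.sub_mul,
          Matrix.add_mul, mul_conjM_mul_conjM_mul, eq_sub_of_add_eq hX.symm, ← hW]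
        abel
      refine sub_eq_zero.mp (hfix _ ?_)
      rw [← mul_conjM_mul_conjM_mul, hD, hD]
end

section
/- Let A ∈ ℂ^{m×m}, B ∈ ℂ^{n×n}, C ∈ ℂ^{m×n}. The equation X = AX̄B + C (unknown X ∈ ℂ^{m×n}) is solvable if and only if the standard Stein equation W = AĀWB̄B + AC̄B + C (unknown W ∈ ℂ^{m×n}) is solvable. Moreover: (i) every solution X of X = AX̄B + C satisfies W = X as a solution of the Stein equation; (ii) the map W ↦ (1/2)(W + AW̄B + C) sends every solution of the Stein equation to a solution of X = AX̄B + C, and every solution of X = AX̄B + C arises in this way; (iii) X = AX̄B + C has a unique solution X★ if and only if the Stein equation has a unique solution W★, and in that case X★ = W★. -/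
open Matrix

/-- The conjugate-linear map `X ↦ AX̄B`. -/
def mulConjMul {m n : ℕ} (A : Matrix (Fin m) (Fin m) ℂ) (B : Matrix (Fin n) (Fin n) ℂ) :
    Matrix (Fin m) (Fin n) ℂ →ₛₗ[starRingEnd ℂ] Matrix (Fin m) (Fin n) ℂ where
  toFun X := A * conjM X * B
  map_add' X Y := by
    simp [conjM, Matrix.map_add, Matrix.mul_add, Matrix.add_mul]
  map_smul' c X := by
    have h : conjM (c • X) = starRingEnd ℂ c • conjM X := by
      ext i j
      simp [conjM]
    simp [h]

theorem mulConjMul_mulConjMul_add {m n : ℕ}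
    (A : Matrix (Fin m) (Fin m) ℂ) (B : Matrix (Fin n) (Fin n) ℂ)
    (C W : Matrix (Fin m) (Fin n) ℂ) :
    A * conjM A * W * (conjM B * B) + A * conjM C * B + C =
      mulConjMul A B (mulConjMul A B W + C) + C := by
  have h : conjM (conjM W) = W := by
    ext i j
    simp [conjM]
  have hmul : conjM (A * conjM W * B) = conjM A * W * conjM B := by
    conv_rhs => rw [← h]
    simp only [conjM, Matrix.map_mul]
  rw [map_add]
  change _ = A * conjM (A * conjM W * B) * B + A * conjM C * B + C
  rw [hmul]
  simp only [Matrix.mul_assoc]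

section ConjugateLinear

variable {E : Type*} [AddCommGroup E] [Module ℂ E] (L : E →ₛₗ[starRingEnd ℂ] E) {c : E}

theorem half_smul_add_isFixed {w : E} (hw : w = L (L w + c) + c) :
    ((1 : ℂ) / 2) • (w + L w + c) = L (((1 : ℂ) / 2) • (w + L w + c)) + c := by
  have hL : L (w + L w + c) = L w + w - c := by
    rw [add_assoc, map_add, eq_sub_iff_add_eq, add_assoc, ← hw]
  rw [map_smulₛₗ, hL]
  simp only [map_div₀, map_one, map_ofNat]
  module

/-- If a conjugate-linear affine map has at most one fixed point, its square has no other one. -/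
theorem eq_of_sq_fixed_of_unique {x w : E} (hx : x = L x + c)
    (huniq : ∀ y, y = L y + c → y = x) (hw : w = L (L w + c) + c) : w = x := by
  have hmid := huniq _ (half_smul_add_isFixed L hw)
  have hsum : w + L w + c = (2 : ℂ) • x := by
    rw [← hmid]
    module
  have hLw : L w = (2 : ℂ) • x - w - c := by
    rw [← hsum]
    abel
  have hLx : L x = x - c := eq_sub_of_add_eq hx.symm
  have hrot : x + Complex.I • (w - x) = x := by
    apply huniq
    rw [map_add, map_smulₛₗ, map_sub, hLw, hLx, Complex.conj_I]
    module
  have hzero : Complex.I • (w - x) = 0 := by simpa using hrot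
  exact sub_eq_zero.mp ((smul_eq_zero.mp hzero).resolve_left Complex.I_ne_zero)

end ConjugateLinear

/-- `X = AX̄B + C` is solvable iff the Stein equation
`W = AĀWB̄B + AC̄B + C` is solvable; every solution of the former solves the latter;
`W ↦ ½(W + AW̄B + C)` maps the solution set of the latter onto that of the former;
and unique solvability is equivalent, with equal unique solutions. -/
theorem eq_AconjXB_iff_stein {m n : ℕ}
    (A : Matrix (Fin m) (Fin m) ℂ) (B : Matrix (Fin n) (Fin n) ℂ)
    (C : Matrix (Fin m) (Fin n) ℂ) :
    ((∃ X : Matrix (Fin m) (Fin n) ℂ, X = A * conjM X * B + C) ↔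
      (∃ W : Matrix (Fin m) (Fin n) ℂ,
        W = A * conjM A * W * (conjM B * B) + A * conjM C * B + C)) ∧
    (∀ X : Matrix (Fin m) (Fin n) ℂ, X = A * conjM X * B + C →
      X = A * conjM A * X * (conjM B * B) + A * conjM C * B + C) ∧
    (∀ W : Matrix (Fin m) (Fin n) ℂ,
      W = A * conjM A * W * (conjM B * B) + A * conjM C * B + C →
        ((1 : ℂ) / 2) • (W + A * conjM W * B + C) =
          A * conjM (((1 : ℂ) / 2) • (W + A * conjM W * B + C)) * B + C) ∧
    (∀ X : Matrix (Fin m) (Fin n) ℂ, X = A * conjM X * B + C →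
      ∃ W : Matrix (Fin m) (Fin n) ℂ,
        W = A * conjM A * W * (conjM B * B) + A * conjM C * B + C ∧
        X = ((1 : ℂ) / 2) • (W + A * conjM W * B + C)) ∧
    ((∃! X : Matrix (Fin m) (Fin n) ℂ, X = A * conjM X * B + C) ↔
      (∃! W : Matrix (Fin m) (Fin n) ℂ,
        W = A * conjM A * W * (conjM B * B) + A * conjM C * B + C)) ∧
    (∀ X₀ : Matrix (Fin m) (Fin n) ℂ,
      (X₀ = A * conjM X₀ * B + C ∧
        ∀ X : Matrix (Fin m) (Fin n) ℂ, X = A * conjM X * B + C → X = X₀) →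
      (X₀ = A * conjM A * X₀ * (conjM B * B) + A * conjM C * B + C ∧
        ∀ W : Matrix (Fin m) (Fin n) ℂ,
          W = A * conjM A * W * (conjM B * B) + A * conjM C * B + C → W = X₀)) := by
  simp only [mulConjMul_mulConjMul_add]
  change ((∃ X, X = mulConjMul A B X + C) ↔
      ∃ W, W = mulConjMul A B (mulConjMul A B W + C) + C) ∧
    (∀ X, X = mulConjMul A B X + C → X = mulConjMul A B (mulConjMul A B X + C) + C) ∧
    (∀ W, W = mulConjMul A B (mulConjMul A B W + C) + C →
      ((1 : ℂ) / 2) • (W + mulConjMul A B W + C) =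
        mulConjMul A B (((1 : ℂ) / 2) • (W + mulConjMul A B W + C)) + C) ∧
    (∀ X, X = mulConjMul A B X + C → ∃ W, W = mulConjMul A B (mulConjMul A B W + C) + C ∧
      X = ((1 : ℂ) / 2) • (W + mulConjMul A B W + C)) ∧
    ((∃! X, X = mulConjMul A B X + C) ↔
      ∃! W, W = mulConjMul A B (mulConjMul A B W + C) + C) ∧
    (∀ X₀, (X₀ = mulConjMul A B X₀ + C ∧ ∀ X, X = mulConjMul A B X + C → X = X₀) →
      (X₀ = mulConjMul A B (mulConjMul A B X₀ + C) + C ∧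
        ∀ W, W = mulConjMul A B (mulConjMul A B W + C) + C → W = X₀))
  generalize mulConjMul A B = L
  have hsq : ∀ X, X = L X + C → X = L (L X + C) + C := fun X hX => by rwa [← hX]
  refine ⟨⟨fun ⟨X, hX⟩ => ⟨X, hsq X hX⟩, fun ⟨W, hW⟩ => ⟨_, half_smul_add_isFixed L hW⟩⟩,
    hsq, fun W hW => half_smul_add_isFixed L hW, fun X hX => ⟨X, hsq X hX, ?_⟩,
    ⟨fun ⟨X, hX, hu⟩ => ⟨X, hsq X hX, fun W hW => eq_of_sq_fixed_of_unique L hX hu hW⟩,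
      fun ⟨W, hW, hu⟩ => ⟨W, ?_, fun X hX => hu X (hsq X hX)⟩⟩,
    fun X ⟨hX, hu⟩ => ⟨hsq X hX, fun W hW => eq_of_sq_fixed_of_unique L hX hu hW⟩⟩
  · rw [add_assoc, ← hX]
    module
  · exact (hu (L W + C) (congrArg (fun Y => L Y + C) hW)).symm
end

section
/- Let A ∈ ℂ^{m×m}, B ∈ ℂ^{n×n}, C ∈ ℂ^{m×n}. The equation X = AX̄B + C (unknown X ∈ ℂ^{m×n}) has a unique solution X★ if and only if the real Stein equation Y = A_σ Y B_σ + C_σ (unknown Y ∈ ℝ^{2m×2n}) has a unique solution Y★. Moreover, in that case Y★ = X★_σ. -/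
open Matrix

/-- The real representation `A_σ = [[A₁, A₂], [A₂, −A₁]] ∈ ℝ^{2m×2n}` of `A = A₁ + iA₂`. -/
def sigmaR {m n : ℕ} (A : Matrix (Fin m) (Fin n) ℂ) :
    Matrix (Fin m ⊕ Fin m) (Fin n ⊕ Fin n) ℝ :=
  Matrix.fromBlocks (A.map Complex.re) (A.map Complex.im)
    (A.map Complex.im) (-(A.map Complex.re))

/-- The block row `[1, e·1]`. -/
def blockRow (m : ℕ) (e : ℂ) : Matrix (Fin m) (Fin m ⊕ Fin m) ℂ :=
  fromCols 1 (e • (1 : Matrix (Fin m) (Fin m) ℂ))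

/-- The block column `[1; e·1]`. -/
def blockCol (n : ℕ) (e : ℂ) : Matrix (Fin n ⊕ Fin n) (Fin n) ℂ :=
  fromRows 1 (e • (1 : Matrix (Fin n) (Fin n) ℂ))

/-- The compression `[1, i] Y [1; e]` of a real block matrix. For `e = i` and `e = -i` it gives
twice the conjugate-linear and twice the complex-linear part of `Y`, respectively. -/
def compress {m n : ℕ} (e : ℂ) (Y : Matrix (Fin m ⊕ Fin m) (Fin n ⊕ Fin n) ℝ) :
    Matrix (Fin m) (Fin n) ℂ :=
  blockRow m Complex.I * Y.map Complex.ofRealHom * blockCol n e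

theorem compress_apply {m n : ℕ} (e : ℂ) (Y : Matrix (Fin m ⊕ Fin m) (Fin n ⊕ Fin n) ℝ)
    (i : Fin m) (j : Fin n) :
    compress e Y i j = (Y (.inl i) (.inl j) + Complex.I * Y (.inr i) (.inl j)) +
      e * (Y (.inl i) (.inr j) + Complex.I * Y (.inr i) (.inr j)) := by
  simp [compress, blockRow, blockCol, Matrix.mul_apply, Fintype.sum_sum_type, Matrix.one_apply,
    mul_comm]

theorem compress_add {m n : ℕ} (e : ℂ) (Y Z : Matrix (Fin m ⊕ Fin m) (Fin n ⊕ Fin n) ℝ) :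
    compress e (Y + Z) = compress e Y + compress e Z := by
  ext i j
  simp only [compress_apply, Matrix.add_apply, Complex.ofReal_add]
  ring

theorem compress_sigmaR {m n : ℕ} (X : Matrix (Fin m) (Fin n) ℂ) :
    compress Complex.I (sigmaR X) = (2 : ℂ) • X := by
  ext i j
  rw [compress_apply]
  apply Complex.ext <;> simp [sigmaR] <;> ring

theorem eq_zero_of_compress_eq_zero {m n : ℕ} {Y : Matrix (Fin m ⊕ Fin m) (Fin n ⊕ Fin n) ℝ}
    (h₁ : compress Complex.I Y = 0) (h₂ : compress (-Complex.I) Y = 0) : Y = 0 := by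
  have key (i : Fin m) (j : Fin n) : Y (.inl i) (.inl j) = 0 ∧ Y (.inl i) (.inr j) = 0 ∧
      Y (.inr i) (.inl j) = 0 ∧ Y (.inr i) (.inr j) = 0 := by
    have e₁ := congrFun₂ h₁ i j
    have e₂ := congrFun₂ h₂ i j
    rw [compress_apply] at e₁ e₂
    simp [Complex.ext_iff] at e₁ e₂
    refine ⟨?_, ?_, ?_, ?_⟩ <;> linarith [e₁.1, e₁.2, e₂.1, e₂.2]
  ext (i | i) (j | j)
  exacts [(key i j).1, (key i j).2.1, (key i j).2.2.1, (key i j).2.2.2]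

theorem blockRow_I_mul_sigmaR {m n : ℕ} (A : Matrix (Fin m) (Fin n) ℂ) :
    blockRow m Complex.I * (sigmaR A).map Complex.ofRealHom = A * blockRow n (-Complex.I) := by
  ext i (j | j) <;> apply Complex.ext <;>
    simp [blockRow, sigmaR, Matrix.mul_apply, Fintype.sum_sum_type, Matrix.one_apply]

theorem sigmaR_mul_blockCol_I {m n : ℕ} (B : Matrix (Fin m) (Fin n) ℂ) :
    (sigmaR B).map Complex.ofRealHom * blockCol n Complex.I = blockCol m (-Complex.I) * B := by
  ext (i | i) j <;> apply Complex.ext <;>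
    simp [blockCol, sigmaR, Matrix.mul_apply, Fintype.sum_sum_type, Matrix.one_apply]

theorem sigmaR_mul_blockCol_neg_I {m n : ℕ} (B : Matrix (Fin m) (Fin n) ℂ) :
    (sigmaR B).map Complex.ofRealHom * blockCol n (-Complex.I) =
      blockCol m Complex.I * conjM B := by
  ext (i | i) j <;> apply Complex.ext <;>
    simp [blockCol, sigmaR, conjM, Matrix.mul_apply, Fintype.sum_sum_type, Matrix.one_apply]

theorem conjM_compress {m n : ℕ} (e : ℂ) (Y : Matrix (Fin m ⊕ Fin m) (Fin n ⊕ Fin n) ℝ) :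
    conjM (compress e Y) = blockRow m (-Complex.I) * Y.map Complex.ofRealHom *
      blockCol n (starRingEnd ℂ e) := by
  ext i j
  simp [conjM, compress_apply, blockRow, blockCol, Matrix.mul_apply, Fintype.sum_sum_type,
    Matrix.one_apply, mul_comm]

theorem compress_I_sigmaR_mul {m n : ℕ} (A : Matrix (Fin m) (Fin m) ℂ)
    (Y : Matrix (Fin m ⊕ Fin m) (Fin n ⊕ Fin n) ℝ) (B : Matrix (Fin n) (Fin n) ℂ) :
    compress Complex.I (sigmaR A * Y * sigmaR B) = A * conjM (compress Complex.I Y) * B := by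
  rw [conjM_compress, Complex.conj_I, compress, Matrix.map_mul, Matrix.map_mul, Matrix.mul_assoc,
    Matrix.mul_assoc, sigmaR_mul_blockCol_I, ← Matrix.mul_assoc, ← Matrix.mul_assoc,
    ← Matrix.mul_assoc, blockRow_I_mul_sigmaR]
  simp only [Matrix.mul_assoc]

theorem compress_neg_I_sigmaR_mul {m n : ℕ} (A : Matrix (Fin m) (Fin m) ℂ)
    (Y : Matrix (Fin m ⊕ Fin m) (Fin n ⊕ Fin n) ℝ) (B : Matrix (Fin n) (Fin n) ℂ) :
    compress (-Complex.I) (sigmaR A * Y * sigmaR B) =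
      A * conjM (compress (-Complex.I) Y) * conjM B := by
  rw [conjM_compress, map_neg, Complex.conj_I, neg_neg, compress, Matrix.map_mul, Matrix.map_mul,
    Matrix.mul_assoc, Matrix.mul_assoc, sigmaR_mul_blockCol_neg_I, ← Matrix.mul_assoc,
    ← Matrix.mul_assoc, ← Matrix.mul_assoc, blockRow_I_mul_sigmaR]
  simp only [Matrix.mul_assoc]

theorem conjM_zero {m n : ℕ} : conjM (0 : Matrix (Fin m) (Fin n) ℂ) = 0 := by
  ext i j
  simp [conjM]

theorem conjM_two_smul {m n : ℕ} (X : Matrix (Fin m) (Fin n) ℂ) :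
    conjM ((2 : ℂ) • X) = (2 : ℂ) • conjM X := by
  simp [two_smul, conjM_add]

theorem sigmaR_add {m n : ℕ} (X Y : Matrix (Fin m) (Fin n) ℂ) :
    sigmaR (X + Y) = sigmaR X + sigmaR Y := by
  ext (i | i) (j | j) <;> simp [sigmaR, add_comm]

theorem sigmaR_injective {m n : ℕ} :
    Function.Injective (sigmaR : Matrix (Fin m) (Fin n) ℂ → _) := by
  intro X Y h
  have h' := congrArg (compress Complex.I) h
  rw [compress_sigmaR, compress_sigmaR] at h'
  exact smul_right_injective _ two_ne_zero h'

theorem sigmaR_mul_conjM_mul {m n : ℕ} (A : Matrix (Fin m) (Fin m) ℂ)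
    (X : Matrix (Fin m) (Fin n) ℂ) (B : Matrix (Fin n) (Fin n) ℂ) :
    sigmaR (A * conjM X * B) = sigmaR A * sigmaR X * sigmaR B := by
  refine sub_eq_zero.mp (eq_zero_of_compress_eq_zero ?_ ?_)
  · rw [← add_left_inj (compress Complex.I (sigmaR A * sigmaR X * sigmaR B)), ← compress_add,
      sub_add_cancel, zero_add, compress_I_sigmaR_mul, compress_sigmaR, compress_sigmaR,
      conjM_two_smul, Matrix.mul_smul, Matrix.smul_mul]
  · have h (Z : Matrix (Fin m) (Fin n) ℂ) : compress (-Complex.I) (sigmaR Z) = 0 := by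
      ext i j
      rw [compress_apply]
      apply Complex.ext <;> simp [sigmaR]
    rw [← add_left_inj (compress (-Complex.I) (sigmaR A * sigmaR X * sigmaR B)), ← compress_add,
      sub_add_cancel, zero_add, compress_neg_I_sigmaR_mul, h, h, conjM_zero, Matrix.mul_zero,
      Matrix.zero_mul]

/-- If `X = AX̄B` has only the trivial solution, then so does `Y = A_σ Y B_σ`. -/
theorem real_stein_eq_zero {m n : ℕ} {A : Matrix (Fin m) (Fin m) ℂ}
    {B : Matrix (Fin n) (Fin n) ℂ}
    (h : ∀ X : Matrix (Fin m) (Fin n) ℂ, X = A * conjM X * B → X = 0)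
    {Y : Matrix (Fin m ⊕ Fin m) (Fin n ⊕ Fin n) ℝ} (hY : Y = sigmaR A * Y * sigmaR B) :
    Y = 0 := by
  refine eq_zero_of_compress_eq_zero (h _ ?_) ?_
  · rw [← compress_I_sigmaR_mul, ← hY]
  · set Z := compress (-Complex.I) Y with hZ
    have hZeq : Z = A * conjM Z * conjM B := by
      rw [hZ, ← compress_neg_I_sigmaR_mul, ← hY]
    have hZB : Z * B = 0 := h _ <| by
      rw [conjM_mul, ← Matrix.mul_assoc, ← hZeq]
    rw [hZeq, Matrix.mul_assoc, ← conjM_mul, hZB, conjM_zero, Matrix.mul_zero]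

/-- `X = AX̄B + C` has a unique solution iff the real Stein equation
`Y = A_σ Y B_σ + C_σ` has a unique solution; moreover the unique solutions are related
by `Y★ = X★_σ`. -/
theorem eq_AconjXB_unique_iff_real_stein {m n : ℕ}
    (A : Matrix (Fin m) (Fin m) ℂ) (B : Matrix (Fin n) (Fin n) ℂ)
    (C : Matrix (Fin m) (Fin n) ℂ) :
    ((∃! X : Matrix (Fin m) (Fin n) ℂ, X = A * conjM X * B + C) ↔
      (∃! Y : Matrix (Fin m ⊕ Fin m) (Fin n ⊕ Fin n) ℝ,
        Y = sigmaR A * Y * sigmaR B + sigmaR C)) ∧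
    (∀ X₀ : Matrix (Fin m) (Fin n) ℂ,
      (X₀ = A * conjM X₀ * B + C ∧
        ∀ X : Matrix (Fin m) (Fin n) ℂ, X = A * conjM X * B + C → X = X₀) →
      (sigmaR X₀ = sigmaR A * sigmaR X₀ * sigmaR B + sigmaR C ∧
        ∀ Y : Matrix (Fin m ⊕ Fin m) (Fin n ⊕ Fin n) ℝ,
          Y = sigmaR A * Y * sigmaR B + sigmaR C → Y = sigmaR X₀)) := by
  have sol {X : Matrix (Fin m) (Fin n) ℂ} (hX : X = A * conjM X * B + C) :
      sigmaR X = sigmaR A * sigmaR X * sigmaR B + sigmaR C := by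
    rw [← sigmaR_mul_conjM_mul, ← sigmaR_add, ← hX]
  have uniq (X₀ : Matrix (Fin m) (Fin n) ℂ) (h₀ : X₀ = A * conjM X₀ * B + C)
      (hu : ∀ X : Matrix (Fin m) (Fin n) ℂ, X = A * conjM X * B + C → X = X₀)
      (Y : Matrix (Fin m ⊕ Fin m) (Fin n ⊕ Fin n) ℝ)
      (hY : Y = sigmaR A * Y * sigmaR B + sigmaR C) : Y = sigmaR X₀ := by
    refine sub_eq_zero.mp (real_stein_eq_zero (A := A) (B := B) (fun X hX => ?_) ?_)
    · refine add_eq_right.mp (hu (X + X₀) ?_)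
      rw [conjM_add, Matrix.mul_add, Matrix.add_mul, add_assoc, ← hX, ← h₀]
    · rw [Matrix.mul_sub, Matrix.sub_mul,
        ← add_sub_add_right_eq_sub (sigmaR A * Y * sigmaR B) _ (sigmaR C), ← hY, ← sol h₀]
  refine ⟨⟨?_, ?_⟩, fun X₀ ⟨h₀, hu⟩ => ⟨sol h₀, uniq X₀ h₀ hu⟩⟩
  · rintro ⟨X₀, h₀, hu⟩
    exact ⟨sigmaR X₀, sol h₀, uniq X₀ h₀ hu⟩
  · rintro ⟨Y, hY, hu⟩
    obtain ⟨X, hX⟩ : ∃ X, compress Complex.I Y = (2 : ℂ) • X :=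
      ⟨(2 : ℂ)⁻¹ • compress Complex.I Y, (smul_inv_smul₀ two_ne_zero _).symm⟩
    refine ⟨X, ?_, fun X' hX' => ?_⟩
    · have h := congrArg (compress Complex.I) hY
      rw [compress_add, compress_I_sigmaR_mul, compress_sigmaR, hX, conjM_two_smul,
        Matrix.mul_smul, Matrix.smul_mul, ← smul_add] at h
      exact smul_right_injective _ two_ne_zero h
    · have h := congrArg (compress Complex.I) (hu _ (sol hX'))
      rw [compress_sigmaR, hX] at h
      exact smul_right_injective _ two_ne_zero h
end

section
/- Let A, B, C ∈ ℂ^{m×n}. The equation X = AXᴴB + C (unknown X ∈ ℂ^{m×n}) is solvable if and only if the standard Stein equation W = ABᴴWAᴴB + ACᴴB + C (unknown W ∈ ℂ^{m×n}) is solvable. Moreover: (i) every solution X of X = AXᴴB + C satisfies W = X as a solution of the Stein equation; (ii) the map W ↦ (1/2)(W + AWᴴB) + (1/2)C sends every solution of the Stein equation to a solution of X = AXᴴB + C, and every solution of X = AXᴴB + C arises in this way; (iii) X = AXᴴB + C has a unique solution X★ if and only if the Stein equation has a unique solution W★ (equivalently, η̄γ ≠ 1 for all eigenvalues η, γ of ABᴴ),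 and in that case X★ = W★. -/
open Matrix

namespace Matrix

theorem mem_spectrum_iff_exists_mulVec_eq_smul {ι : Type*} [Fintype ι] [DecidableEq ι]
    (M : Matrix ι ι ℂ) (μ : ℂ) :
    μ ∈ spectrum ℂ M ↔ ∃ v : ι → ℂ, v ≠ 0 ∧ M *ᵥ v = μ • v := by
  rw [← Matrix.spectrum_toLin', ← Module.End.hasEigenvalue_iff_mem_spectrum]
  constructor
  · intro h
    obtain ⟨v, hv⟩ := h.exists_hasEigenvector
    exact ⟨v, hv.2, by simpa using hv.apply_eq_smul⟩
  · rintro ⟨v, hv, h⟩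
    exact Module.End.hasEigenvalue_of_hasEigenvector
      ⟨Module.End.mem_eigenspace_iff.2 (by simpa using h), hv⟩

variable {ι κ : Type*} [Fintype ι] [Fintype κ]

/-- A nonzero matrix fixed by `Z ↦ P * Z * Q` can be chosen with all rows left eigenvectors
of `Q`, with a common eigenvalue. -/
theorem exists_eigen_of_eq_mul_mul {P : Matrix ι ι ℂ} {Q : Matrix κ κ ℂ} {Z : Matrix ι κ ℂ}
    (hZ : Z ≠ 0) (h : Z = P * Z * Q) :
    ∃ (μ : ℂ) (Y : Matrix ι κ ℂ), Y ≠ 0 ∧ Y = P * Y * Q ∧ Y * Q = μ • Y := by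
  let K : Submodule ℂ (Matrix ι κ ℂ) :=
    { carrier := {Y | Y = P * Y * Q}
      zero_mem' := by simp
      add_mem' := fun {a b} ha hb => by
        simp only [Set.mem_ofPred_eq] at *
        rw [Matrix.mul_add, Matrix.add_mul, ← ha, ← hb]
      smul_mem' := fun c a ha => by
        simp only [Set.mem_ofPred_eq] at *
        rw [Matrix.mul_smul, Matrix.smul_mul, ← ha] }
  let R : K →ₗ[ℂ] K :=
    { toFun := fun Y => ⟨Y.1 * Q, by
        have hY : Y.1 = P * Y.1 * Q := Y.2
        change Y.1 * Q = P * (Y.1 * Q) * Q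
        rw [← Matrix.mul_assoc P, ← hY]⟩
      map_add' := fun a b => Subtype.ext (Matrix.add_mul _ _ _)
      map_smul' := fun c a => Subtype.ext (Matrix.smul_mul _ _ _) }
  have : Nontrivial K := ⟨⟨⟨Z, h⟩, 0, fun e => hZ (congrArg Subtype.val e)⟩⟩
  obtain ⟨μ, hμ⟩ := Module.End.exists_eigenvalue R
  obtain ⟨Y, hY⟩ := hμ.exists_hasEigenvector
  exact ⟨μ, Y.1, fun e => hY.2 (Subtype.ext e), Y.2, congrArg Subtype.val hY.apply_eq_smul⟩

theorem forall_eq_mul_mul_imp_eq_zero_iff [DecidableEq ι] (A B : Matrix ι κ ℂ) :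
    (∀ Z : Matrix ι κ ℂ, Z = A * Bᴴ * Z * (Aᴴ * B) → Z = 0) ↔
      ∀ η ∈ spectrum ℂ (A * Bᴴ), ∀ γ ∈ spectrum ℂ (A * Bᴴ), (starRingEnd ℂ) η * γ ≠ 1 := by
  constructor
  · intro h η hη γ hγ hηγ
    obtain ⟨x, hx, hxe⟩ := (mem_spectrum_iff_exists_mulVec_eq_smul _ _).1 hη
    obtain ⟨u, hu, hue⟩ := (mem_spectrum_iff_exists_mulVec_eq_smul _ _).1 hγ
    have hx' : (star x ᵥ* B) ᵥ* Aᴴ = star η • star x := by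
      have := congrArg star hxe
      rwa [star_mulVec, star_smul, conjTranspose_mul, conjTranspose_conjTranspose,
        ← vecMul_vecMul] at this
    have hη0 : star η ≠ 0 := fun e => zero_ne_one <| by rwa [starRingEnd_apply, e, zero_mul] at hηγ
    have hv : star x ᵥ* B ≠ 0 := fun e => by
      rw [e, zero_vecMul, eq_comm, smul_eq_zero] at hx'
      exact hx'.elim hη0 fun e => hx (star_eq_zero.1 e)
    have hZ : vecMulVec u (star x ᵥ* B) = 0 := by
      apply h
      rw [mul_vecMulVec, vecMulVec_mul, hue, ← vecMul_vecMul, hx', smul_vecMul, smul_vecMulVec,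
        vecMulVec_smul, smul_smul, mul_comm γ]
      rw [← starRingEnd_apply η, hηγ, one_smul]
    obtain ⟨i, hi⟩ := Function.ne_iff.1 hu
    obtain ⟨j, hj⟩ := Function.ne_iff.1 hv
    exact mul_ne_zero hi hj (congrFun (congrFun hZ i) j)
  · intro h Z hZe
    by_contra hZ
    obtain ⟨μ, Y, hY, hYe, hμ⟩ := exists_eigen_of_eq_mul_mul hZ hZe
    have hPY : Y = μ • (A * Bᴴ * Y) := by
      rwa [Matrix.mul_assoc _ Y, hμ, Matrix.mul_smul] at hYe
    have hμ0 : μ ≠ 0 := fun e => hY (by rw [hPY, e, zero_smul])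
    obtain ⟨i, j, hij⟩ : ∃ i j, Y i j ≠ 0 := by
      by_contra! hc
      exact hY (Matrix.ext hc)
    have hγ : μ⁻¹ ∈ spectrum ℂ (A * Bᴴ) := by
      refine (mem_spectrum_iff_exists_mulVec_eq_smul _ _).2
        ⟨Y.col j, fun e => hij (congrFun e i), ?_⟩
      have hc : Y.col j = μ • ((A * Bᴴ) *ᵥ Y.col j) := funext fun k => congrFun (congrFun hPY k) j
      rw [eq_inv_smul_iff₀ hμ0, ← hc]
    have hrow : (Y.row i ᵥ* Aᴴ) ᵥ* B = μ • Y.row i := by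
      rw [vecMul_vecMul]
      exact congrFun hμ i
    have hη : star μ ∈ spectrum ℂ (A * Bᴴ) := by
      refine (mem_spectrum_iff_exists_mulVec_eq_smul _ _).2
        ⟨star (Y.row i ᵥ* Aᴴ), fun e => ?_, ?_⟩
      · rw [star_eq_zero.1 e, zero_vecMul, eq_comm, smul_eq_zero] at hrow
        exact hrow.elim hμ0 fun e => hij (congrFun e j)
      · rw [← star_smul, ← smul_vecMul, ← hrow]
        simp [star_vecMul, mulVec_mulVec, Matrix.mul_assoc]
    refine h _ hη _ hγ ?_
    rw [starRingEnd_apply, star_star, mul_inv_cancel₀ hμ0]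

theorem existsUnique_eq_mul_mul_add_iff (P : Matrix ι ι ℂ) (Q : Matrix κ κ ℂ)
    (D : Matrix ι κ ℂ) :
    (∃! W : Matrix ι κ ℂ, W = P * W * Q + D) ↔
      ∀ Z : Matrix ι κ ℂ, Z = P * Z * Q → Z = 0 := by
  constructor
  · rintro ⟨W, hW, hu⟩ Z hZ
    have : W + Z = W := hu _ (by
      simp only at hW ⊢
      rw [Matrix.mul_add, Matrix.add_mul, ← hZ, add_right_comm, ← hW])
    simpa using this
  · intro h
    let S : Matrix ι κ ℂ →ₗ[ℂ] Matrix ι κ ℂ :=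
      { toFun := fun W => W - P * W * Q
        map_add' := fun a b => by rw [Matrix.mul_add, Matrix.add_mul]; abel
        map_smul' := fun c a => by simp [smul_sub] }
    have hS : Function.Injective S := (injective_iff_map_eq_zero S).2 fun Z hZ =>
      h Z (sub_eq_zero.1 hZ)
    obtain ⟨W, hW⟩ := (LinearMap.injective_iff_surjective.1 hS) D
    refine ⟨W, sub_eq_iff_eq_add'.1 hW, fun V hV => hS ?_⟩
    rw [hW]
    exact sub_eq_iff_eq_add'.2 hV

end Matrix

/-- `X = AXᴴB + C` is solvable iff the Stein equation
`W = ABᴴWAᴴB + ACᴴB + C` is solvable; every solution of the former solves the latter;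
`W ↦ ½(W + AWᴴB) + ½C` maps the solution set of the latter onto that of the former;
unique solvability of the two equations is equivalent (equivalently, `η̄γ ≠ 1` for all
eigenvalues `η, γ` of `ABᴴ`), and the unique solutions coincide. -/
theorem eq_AXHB_iff_stein {m n : ℕ} (A B C : Matrix (Fin m) (Fin n) ℂ) :
    ((∃ X : Matrix (Fin m) (Fin n) ℂ, X = A * Xᴴ * B + C) ↔
      (∃ W : Matrix (Fin m) (Fin n) ℂ, W = A * Bᴴ * W * Aᴴ * B + A * Cᴴ * B + C)) ∧
    (∀ X : Matrix (Fin m) (Fin n) ℂ, X = A * Xᴴ * B + C →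
      X = A * Bᴴ * X * Aᴴ * B + A * Cᴴ * B + C) ∧
    (∀ W : Matrix (Fin m) (Fin n) ℂ, W = A * Bᴴ * W * Aᴴ * B + A * Cᴴ * B + C →
      ((1 : ℂ) / 2) • (W + A * Wᴴ * B) + ((1 : ℂ) / 2) • C =
        A * (((1 : ℂ) / 2) • (W + A * Wᴴ * B) + ((1 : ℂ) / 2) • C)ᴴ * B + C) ∧
    (∀ X : Matrix (Fin m) (Fin n) ℂ, X = A * Xᴴ * B + C →
      ∃ W : Matrix (Fin m) (Fin n) ℂ, W = A * Bᴴ * W * Aᴴ * B + A * Cᴴ * B + C ∧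
        X = ((1 : ℂ) / 2) • (W + A * Wᴴ * B) + ((1 : ℂ) / 2) • C) ∧
    ((∃! X : Matrix (Fin m) (Fin n) ℂ, X = A * Xᴴ * B + C) ↔
      (∃! W : Matrix (Fin m) (Fin n) ℂ, W = A * Bᴴ * W * Aᴴ * B + A * Cᴴ * B + C)) ∧
    ((∃! W : Matrix (Fin m) (Fin n) ℂ, W = A * Bᴴ * W * Aᴴ * B + A * Cᴴ * B + C) ↔
      ∀ η ∈ spectrum ℂ (A * Bᴴ), ∀ γ ∈ spectrum ℂ (A * Bᴴ),
        (starRingEnd ℂ) η * γ ≠ 1) ∧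
    (∀ X₀ : Matrix (Fin m) (Fin n) ℂ,
      (X₀ = A * X₀ᴴ * B + C ∧
        ∀ X : Matrix (Fin m) (Fin n) ℂ, X = A * Xᴴ * B + C → X = X₀) →
      (X₀ = A * Bᴴ * X₀ * Aᴴ * B + A * Cᴴ * B + C ∧
        ∀ W : Matrix (Fin m) (Fin n) ℂ,
          W = A * Bᴴ * W * Aᴴ * B + A * Cᴴ * B + C → W = X₀)) := by
  have hT (X : Matrix (Fin m) (Fin n) ℂ) :
      A * (A * Xᴴ * B)ᴴ * B = A * Bᴴ * X * Aᴴ * B := by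
    simp [Matrix.mul_assoc]
  have h_imp (X : Matrix (Fin m) (Fin n) ℂ) (hX : X = A * Xᴴ * B + C) :
      X = A * Bᴴ * X * Aᴴ * B + A * Cᴴ * B + C := by
    rw [← hT, ← Matrix.add_mul, ← Matrix.mul_add, ← conjTranspose_add, ← hX, ← hX]
  have h_avg (W : Matrix (Fin m) (Fin n) ℂ)
      (hW : W = A * Bᴴ * W * Aᴴ * B + A * Cᴴ * B + C) :
      ((1 : ℂ) / 2) • (W + A * Wᴴ * B) + ((1 : ℂ) / 2) • C =
        A * (((1 : ℂ) / 2) • (W + A * Wᴴ * B) + ((1 : ℂ) / 2) • C)ᴴ * B + C := by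
    have hstar : star ((1 : ℂ) / 2) = 1 / 2 := by simp
    simp only [conjTranspose_add, conjTranspose_smul, hstar, Matrix.mul_add, Matrix.add_mul,
      Matrix.mul_smul, Matrix.smul_mul, hT, smul_add]
    nth_rewrite 1 [hW]
    module
  have h_surj (X : Matrix (Fin m) (Fin n) ℂ) (hX : X = A * Xᴴ * B + C) :
      X = ((1 : ℂ) / 2) • (X + A * Xᴴ * B) + ((1 : ℂ) / 2) • C := by
    rw [← smul_add, add_assoc, ← hX]
    module
  have h_stein (D : Matrix (Fin m) (Fin n) ℂ) :
      A * Bᴴ * D * Aᴴ * B = A * Bᴴ * D * (Aᴴ * B) := Matrix.mul_assoc _ _ _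
  have h_uniq : (∃! W : Matrix (Fin m) (Fin n) ℂ,
      W = A * Bᴴ * W * Aᴴ * B + A * Cᴴ * B + C) ↔
      ∀ Z : Matrix (Fin m) (Fin n) ℂ, Z = A * Bᴴ * Z * (Aᴴ * B) → Z = 0 := by
    simp only [h_stein, add_assoc]
    exact existsUnique_eq_mul_mul_add_iff _ _ _
  have h_ker (X₀ : Matrix (Fin m) (Fin n) ℂ) (hX₀ : X₀ = A * X₀ᴴ * B + C)
      (hu : ∀ X : Matrix (Fin m) (Fin n) ℂ, X = A * Xᴴ * B + C → X = X₀)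
      (Z : Matrix (Fin m) (Fin n) ℂ) (hZ : Z = A * Bᴴ * Z * (Aᴴ * B)) : Z = 0 := by
    have hfix (Y : Matrix (Fin m) (Fin n) ℂ) (hY : Y = A * Yᴴ * B) : Y = 0 := by
      have : X₀ + Y = X₀ := hu _ (by
        rw [conjTranspose_add, Matrix.mul_add, Matrix.add_mul, ← hY, add_right_comm, ← hX₀])
      simpa using this
    rw [← h_stein, ← hT] at hZ
    have h_neg : Z + A * Zᴴ * B = 0 := hfix _ (by
      rw [conjTranspose_add, Matrix.mul_add, Matrix.add_mul, ← hZ, add_comm])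
    have h_I : Complex.I • Z = 0 := hfix _ (by
      rw [conjTranspose_smul, Matrix.mul_smul, Matrix.smul_mul,
        eq_neg_of_add_eq_zero_right h_neg]
      simp)
    exact (smul_eq_zero.1 h_I).resolve_left Complex.I_ne_zero
  refine ⟨⟨fun ⟨X, hX⟩ => ⟨X, h_imp X hX⟩, fun ⟨W, hW⟩ => ⟨_, h_avg W hW⟩⟩, h_imp, h_avg,
    fun X hX => ⟨X, h_imp X hX, h_surj X hX⟩, ⟨?_, ?_⟩, ?_, ?_⟩
  · rintro ⟨X, hX, hu⟩
    exact h_uniq.2 (h_ker X hX hu)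
  · rintro ⟨W, hW, hu⟩
    refine ⟨_, h_avg W hW, fun X hX => ?_⟩
    rw [hu X (h_imp X hX)]
    exact (hu _ (h_imp _ (h_avg W hW))).symm
  · exact h_uniq.trans (forall_eq_mul_mul_imp_eq_zero_iff A B)
  · rintro X₀ ⟨hX₀, hu⟩
    exact ⟨h_imp X₀ hX₀, fun W hW =>
      (h_uniq.2 (h_ker X₀ hX₀ hu)).unique hW (h_imp X₀ hX₀)⟩
end
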